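/- Let (Λ,η) be a full isothermic surface in S^n, n ≥ 3, and let w ∈ ℝ^{n+1,1} be nonzero. Then (Λ,η) is a special isothermic surface of type 1 in the space-form E(w) if and only if the lift F : Σ → E(w) of Λ is a generalised H-surface, i.e., F admits a unit normal vector field N, parallel with respect to the normal connection, such that (𝐇,N) is constant, where 𝐇 is the mean curvature vector of F in E(w). -/

import Mathlib

noncomputable section

open Finset

/-- Minkowski space `ℝ^{n+1,1}`, modelled on `Fin (n+2) → ℝ`. -/
abbrev MV (n : ℕ) : Type := EuclideanSpace ℝ (Fin (n + 2))

/-- The Minkowski inner product of signature `(n+1,1)`. -/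
def mink (n : ℕ) (x y : MV n) : ℝ :=
  ∑ i : Fin (n + 1), x i.castSucc * y i.castSucc
    - x (Fin.last (n + 1)) * y (Fin.last (n + 1))

/-- The light cone `L ⊂ ℝ^{n+1,1}`. -/
def LightCone (n : ℕ) : Set (MV n) := {v | v ≠ 0 ∧ mink n v v = 0}

/-- The skew endomorphism `u ∧ v`, acting by `(u ∧ v) w = (u,w)v − (v,w)u`. -/
def wedge (n : ℕ) (u v w : MV n) : MV n :=
  mink n u w • v - mink n v w • u

/-- The surface domain: a two-dimensional coordinate chart. -/
abbrev Surf : Type := ℝ × ℝ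

/-- the coordinate direction ∂/∂u -/
def du : Surf := (1, 0)

/-- the coordinate direction ∂/∂v -/
def dv : Surf := (0, 1)

/-- partial derivative of a section in a coordinate direction -/
def pd {n : ℕ} (e : Surf) (f : Surf → MV n) (x : Surf) : MV n :=
  fderiv ℝ f x e

lemma mink_add_left (n : ℕ) (a b c : MV n) :
    mink n (a + b) c = mink n a c + mink n b c := by
  simp [mink, PiLp.add_apply, add_mul, Finset.sum_add_distrib]; ring

lemma mink_smul_left (n : ℕ) (r : ℝ) (a c : MV n) :
    mink n (r • a) c = r * mink n a c := by
  simp [mink, PiLp.smul_apply, smul_eq_mul, mul_sub, Finset.mul_sum, mul_assoc]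

lemma mink_zero_left (n : ℕ) (c : MV n) : mink n 0 c = 0 := by
  simp [mink]

/-- An isothermic surface `(Λ,η)` in `S^n = P(L)`, given by a nowhere-zero null
lift `F` of the immersion `Λ` together with the 1-form
`η = F ∧ W₁ du + F ∧ W₂ dv` with values in `Λ ∧ Λ^⊥`. -/
structure IsothermicSurface (n : ℕ) : Type where
  F : Surf → MV n
  W₁ : Surf → MV n
  W₂ : Surf → MV n
  smooth_F : ContDiff ℝ (⊤ : ℕ∞) F
  smooth_W₁ : ContDiff ℝ (⊤ : ℕ∞) W₁
  smooth_W₂ : ContDiff ℝ (⊤ : ℕ∞) W₂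
  F_ne : ∀ x, F x ≠ 0
  F_null : ∀ x, mink n (F x) (F x) = 0
  immersed : ∀ x, LinearIndependent ℝ ![F x, pd du F x, pd dv F x]
  W₁_perp : ∀ x, mink n (F x) (W₁ x) = 0
  W₂_perp : ∀ x, mink n (F x) (W₂ x) = 0
  eta_ne : ∃ x z, wedge n (F x) (W₁ x) z ≠ 0 ∨ wedge n (F x) (W₂ x) z ≠ 0
  eta_closed : ∀ x z,
    fderiv ℝ (fun y => wedge n (F y) (W₂ y) z) x du
      = fderiv ℝ (fun y => wedge n (F y) (W₁ y) z) x dv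

/-- `s` is a parallel section for the flat connection `∇^t = d + tη`. -/
def ParallelSection (n : ℕ) (S : IsothermicSurface n) (t : ℝ)
    (s : Surf → MV n) : Prop :=
  ∀ x, fderiv ℝ s x du + t • wedge n (S.F x) (S.W₁ x) (s x) = 0
     ∧ fderiv ℝ s x dv + t • wedge n (S.F x) (S.W₂ x) (s x) = 0

/-- A polynomial conserved quantity of degree `d` of the isothermic surface
`(Λ,η)`: a polynomial `p(t) = Σ_{k=0}^d p_k t^k` of (smooth) sections, of exact
degree `d`, with `∇^t p(t) = 0` for all `t`. -/
structure PolyConservedQuantity (n : ℕ) (S : IsothermicSurface n) (d : ℕ) : Type where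
  coeff : ℕ → Surf → MV n
  smooth : ∀ k, ContDiff ℝ (⊤ : ℕ∞) (coeff k)
  coeff_eq_zero : ∀ k, d < k → coeff k = 0
  top_ne : coeff d ≠ 0
  conserved : ∀ t : ℝ, ParallelSection n S t
    (fun x => ∑ k ∈ Finset.range (d + 1), t ^ k • coeff k x)

/-- evaluation `p(t)` of a polynomial conserved quantity -/
def pcEval {n : ℕ} {S : IsothermicSurface n} {d : ℕ}
    (p : PolyConservedQuantity n S d) (t : ℝ) (x : Surf) : MV n :=
  ∑ k ∈ Finset.range (d + 1), t ^ k • p.coeff k x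

/-- `(Λ,η)` is a special isothermic surface of type `d`. -/
def SpecialOfType (n : ℕ) (S : IsothermicSurface n) (d : ℕ) : Prop :=
  Nonempty (PolyConservedQuantity n S d)

/-- `p₀ ∈ ⟨w⟩`: the polynomial conserved quantity exhibits `(Λ,η)` as special
isothermic in the space-form `E(w)`. -/
def InSpaceForm {n : ℕ} {S : IsothermicSurface n} {d : ℕ}
    (p : PolyConservedQuantity n S d) (w : MV n) : Prop :=
  ∃ c : ℝ, ∀ x, p.coeff 0 x = c • w

/-- fullness: the image of `Λ` lies in no proper subsphere -/
def Full (n : ℕ) (S : IsothermicSurface n) : Prop :=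
  ¬ ∃ p : MV n, p ≠ 0 ∧ ∀ x, mink n p (S.F x) = 0
/-- A Darboux transform `Λ̂` of `(Λ,η)` with parameter `m`, given by a
`∇^m`-parallel null lift `G` spanning an immersed surface with `Λ̂ ∩ Λ = 0`. -/
structure DarbouxTransform (n : ℕ) (S : IsothermicSurface n) (m : ℝ) : Type where
  G : Surf → MV n
  smooth_G : ContDiff ℝ (⊤ : ℕ∞) G
  G_ne : ∀ x, G x ≠ 0
  G_null : ∀ x, mink n (G x) (G x) = 0
  immersed : ∀ x, LinearIndependent ℝ ![G x, pd du G x, pd dv G x]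
  disjoint : ∀ x, G x ∉ Submodule.span ℝ {S.F x}
  parallel : ParallelSection n S m G

/-- The gauge transformation `Γ_{⟨F⟩}^{⟨G⟩}(c)`: acts as `c` on `⟨G⟩`, as `1` on
`(⟨F⟩ ⊕ ⟨G⟩)^⊥` and as `c⁻¹` on `⟨F⟩`. -/
def gaugeG (n : ℕ) (F G : MV n) (c : ℝ) (z : MV n) : MV n :=
  ((mink n G z / mink n F G) / c) • F
    + (c * (mink n F z / mink n F G)) • G
    + (z - (mink n G z / mink n F G) • F - (mink n F z / mink n F G) • G)

/-- `Γ_Λ^{Λ̂}(1 − t/m) · (d + tη) = d + tη̂` for all `t ≠ m`: the gauge relation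
between the pencils of flat connections of an isothermic surface `S` and of (an
isothermic structure `T` on) its Darboux transform with parameter `m`. -/
def GaugeRel (n : ℕ) (S T : IsothermicSurface n) (m : ℝ) : Prop :=
  ∀ t : ℝ, t ≠ m → ∀ s : Surf → MV n, ContDiff ℝ (⊤ : ℕ∞) s → ∀ x : Surf,
    (fderiv ℝ (fun y => gaugeG n (S.F y) (T.F y) (1 - t / m) (s y)) x du
        + t • wedge n (T.F x) (T.W₁ x) (gaugeG n (S.F x) (T.F x) (1 - t / m) (s x))
      = gaugeG n (S.F x) (T.F x) (1 - t / m)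
          (fderiv ℝ s x du + t • wedge n (S.F x) (S.W₁ x) (s x)))
    ∧ (fderiv ℝ (fun y => gaugeG n (S.F y) (T.F y) (1 - t / m) (s y)) x dv
        + t • wedge n (T.F x) (T.W₂ x) (gaugeG n (S.F x) (T.F x) (1 - t / m) (s x))
      = gaugeG n (S.F x) (T.F x) (1 - t / m)
          (fderiv ℝ s x dv + t • wedge n (S.F x) (S.W₂ x) (s x)))

/-- `Λ̂ = ⟨p(m)⟩` with `(p(m),p(m)) = 0`: the Darboux transform `D` is a
complementary surface of `(Λ,η)` with respect to `p(t)`. -/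
def IsComplementary (n : ℕ) {S : IsothermicSurface n} {d : ℕ}
    (p : PolyConservedQuantity n S d) {m : ℝ} (D : DarbouxTransform n S m) : Prop :=
  (∀ x, mink n (pcEval p m x) (pcEval p m x) = 0) ∧
  (∀ x, Submodule.span ℝ {D.G x} = Submodule.span ℝ {pcEval p m x})

/-- `m` is a repeated root of the (constant-coefficient) polynomial `(p(t),p(t))`. -/
def IsRepeatedRootAt {n : ℕ} {S : IsothermicSurface n} {d : ℕ}
    (p : PolyConservedQuantity n S d) (m : ℝ) : Prop :=
  ∀ x, mink n (pcEval p m x) (pcEval p m x) = 0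
    ∧ deriv (fun t : ℝ => mink n (pcEval p t x) (pcEval p t x)) m = 0
/-- metric coefficient `g₁₁ = (F_u,F_u)` of the induced metric -/
def gUU (n : ℕ) (F : Surf → MV n) (x : Surf) : ℝ := mink n (pd du F x) (pd du F x)

/-- metric coefficient `g₁₂ = (F_u,F_v)` -/
def gUV (n : ℕ) (F : Surf → MV n) (x : Surf) : ℝ := mink n (pd du F x) (pd dv F x)

/-- metric coefficient `g₂₂ = (F_v,F_v)` -/
def gVV (n : ℕ) (F : Surf → MV n) (x : Surf) : ℝ := mink n (pd dv F x) (pd dv F x)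

/-- `(𝐇, N)`, the inner product of the mean curvature vector of `F` (in a
space-form `E(w)`) with a normal field `N`: half the trace with respect to the
induced metric of the `N`-component of the second fundamental form. -/
def meanCurv (n : ℕ) (F N : Surf → MV n) (x : Surf) : ℝ :=
  (gVV n F x * mink n (pd du (pd du F) x) (N x)
    - 2 * gUV n F x * mink n (pd du (pd dv F) x) (N x)
    + gUU n F x * mink n (pd dv (pd dv F) x) (N x))
  / (2 * (gUU n F x * gVV n F x - gUV n F x ^ 2))

/-- `N` is a unit normal field of the lift `F : Σ → E(w)`. -/
def IsUnitNormal (n : ℕ) (F N : Surf → MV n) (w : MV n) : Prop :=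
  (∀ x, mink n (N x) (N x) = 1) ∧ (∀ x, mink n (N x) w = 0)
    ∧ (∀ x, mink n (N x) (F x) = 0)
    ∧ (∀ x, mink n (N x) (pd du F x) = 0) ∧ (∀ x, mink n (N x) (pd dv F x) = 0)

/-- `N` is parallel for the normal connection of `F : Σ → E(w)`: the derivative
of `N` has no component in the normal bundle of `F` in `E(w)`. -/
def ParallelNormal (n : ℕ) (F N : Surf → MV n) (w : MV n) : Prop :=
  ∀ x e, fderiv ℝ N x e ∈ Submodule.span ℝ {F x, pd du F x, pd dv F x, w}

/-- the chart coordinates `(u,v)` are conformal curvature line coordinates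
corresponding to `η`, with conformal factor `e^{2θ}`:
`I = e^{2θ}(du² + dv²)` and `η = e^{−2θ} F ∧ (−F_u du + F_v dv)`. -/
def ConformalCoords (n : ℕ) (S : IsothermicSurface n) (θ : Surf → ℝ) : Prop :=
  ContDiff ℝ (⊤ : ℕ∞) θ
  ∧ (∀ x, mink n (pd du S.F x) (pd du S.F x) = Real.exp (2 * θ x))
  ∧ (∀ x, mink n (pd dv S.F x) (pd dv S.F x) = Real.exp (2 * θ x))
  ∧ (∀ x, mink n (pd du S.F x) (pd dv S.F x) = 0)
  ∧ (∀ x z, wedge n (S.F x) (S.W₁ x) z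
      = Real.exp (-(2 * θ x)) • wedge n (S.F x) (-pd du S.F x) z)
  ∧ (∀ x z, wedge n (S.F x) (S.W₂ x) z
      = Real.exp (-(2 * θ x)) • wedge n (S.F x) (pd dv S.F x) z)

/-- the second fundamental form of the lift `F` in `E(w)` with respect to the
unit normal `N` is `II = e^{2θ}(k₁ du² + k₂ dv²)`. -/
def PrincipalCurvatures (n : ℕ) (S : IsothermicSurface n) (N : Surf → MV n)
    (θ k₁ k₂ : Surf → ℝ) : Prop :=
  (∀ x, mink n (pd du (pd du S.F) x) (N x) = Real.exp (2 * θ x) * k₁ x)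
  ∧ (∀ x, mink n (pd du (pd dv S.F) x) (N x) = 0)
  ∧ (∀ x, mink n (pd dv (pd dv S.F) x) (N x) = Real.exp (2 * θ x) * k₂ x)

/-- partial derivative of a real function on the surface -/
def pdR (e : Surf) (f : Surf → ℝ) (x : Surf) : ℝ := fderiv ℝ f x e
/-- `(Λ^c, η^c)` is the Christoffel transform of `(Λ,η)` with respect to the
pair `(v∞, v₀)`, witnessed by the stereoprojections `f`, `f^c` into
`ℝ^n = ⟨v₀,v∞⟩^⊥`:  `F = exp(f ∧ v∞)v₀`, `F^c = exp(f^c ∧ v₀)v∞`,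
`η = Ad(exp(f ∧ v∞))(df^c ∧ v₀)` and `η^c = Ad(exp(f^c ∧ v₀))(df ∧ v∞)`. -/
def IsChristoffelPair (n : ℕ) (S Sc : IsothermicSurface n) (vinf v0 : MV n)
    (f fc : Surf → MV n) : Prop :=
  vinf ∈ LightCone n ∧ v0 ∈ LightCone n ∧ mink n v0 vinf = -1
  ∧ ContDiff ℝ (⊤ : ℕ∞) f ∧ ContDiff ℝ (⊤ : ℕ∞) fc
  ∧ (∀ x, mink n (f x) v0 = 0) ∧ (∀ x, mink n (f x) vinf = 0)
  ∧ (∀ x, mink n (fc x) v0 = 0) ∧ (∀ x, mink n (fc x) vinf = 0)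
  ∧ (∀ x, S.F x = v0 + f x + (mink n (f x) (f x) / 2) • vinf)
  ∧ (∀ x, Sc.F x = vinf + fc x + (mink n (fc x) (fc x) / 2) • v0)
  ∧ (∀ x z, wedge n (S.F x) (S.W₁ x) z
      = wedge n (pd du fc x + mink n (f x) (pd du fc x) • vinf) (S.F x) z)
  ∧ (∀ x z, wedge n (S.F x) (S.W₂ x) z
      = wedge n (pd dv fc x + mink n (f x) (pd dv fc x) • vinf) (S.F x) z)
  ∧ (∀ x z, wedge n (Sc.F x) (Sc.W₁ x) z
      = wedge n (pd du f x + mink n (fc x) (pd du f x) • v0) (Sc.F x) z)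
  ∧ (∀ x z, wedge n (Sc.F x) (Sc.W₂ x) z
      = wedge n (pd dv f x + mink n (fc x) (pd dv f x) • v0) (Sc.F x) z)

/-- `Φ` is an orthogonal gauge transformation with `Φ · (d + sη) = d`. -/
def IsTGauge (n : ℕ) (S : IsothermicSurface n) (s : ℝ)
    (Φ : Surf → MV n → MV n) : Prop :=
  (∀ x, IsLinearMap ℝ (Φ x))
  ∧ (∀ x z z', mink n (Φ x z) (Φ x z') = mink n z z')
  ∧ (∀ σ : Surf → MV n, ContDiff ℝ (⊤ : ℕ∞) σ → ∀ x,
      (fderiv ℝ (fun y => Φ y (σ y)) x du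
         = Φ x (fderiv ℝ σ x du + s • wedge n (S.F x) (S.W₁ x) (σ x)))
      ∧ (fderiv ℝ (fun y => Φ y (σ y)) x dv
         = Φ x (fderiv ℝ σ x dv + s • wedge n (S.F x) (S.W₂ x) (σ x))))

/-- `(Λ_s, η_s)` is the T-transform of `(Λ,η)` associated to `Φ_s`:
`Λ_s = Φ_s Λ` and `η_s = Ad(Φ_s) η`. -/
def IsTTransform (n : ℕ) (S : IsothermicSurface n) (s : ℝ)
    (Φ : Surf → MV n → MV n) (Ss : IsothermicSurface n) : Prop :=
  IsTGauge n S s Φ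
  ∧ (∀ x, Ss.F x = Φ x (S.F x))
  ∧ (∀ x z, wedge n (Ss.F x) (Ss.W₁ x) (Φ x z) = Φ x (wedge n (S.F x) (S.W₁ x) z))
  ∧ (∀ x z, wedge n (Ss.F x) (Ss.W₂ x) (Φ x z) = Φ x (wedge n (S.F x) (S.W₂ x) z))

/-- orthogonal complement with respect to the Minkowski form -/
def mperp (n : ℕ) (U : Submodule ℝ (MV n)) : Submodule ℝ (MV n) where
  carrier := {v | ∀ u ∈ U, mink n v u = 0}
  add_mem' := by
    intro a b ha hb u hu
    rw [mink_add_left, ha u hu, hb u hu, add_zero]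
  zero_mem' := by
    intro u hu; exact mink_zero_left n u
  smul_mem' := by
    intro r a ha u hu
    rw [mink_smul_left, ha u hu, mul_zero]

/-- the spherical system of `Λ` and a Darboux transform `Λ̂ = ⟨G⟩`: the
`(n−2)`-sphere congruence `C = Λ ⊕ Λ̂ ⊕ V_R^⊥`, `V_R = Λ^{(1)} ⊕ Λ̂`. -/
def sphericalSystem (n : ℕ) (S : IsothermicSurface n) (G : Surf → MV n)
    (x : Surf) : Submodule ℝ (MV n) :=
  Submodule.span ℝ {S.F x, G x}
    ⊔ mperp n (Submodule.span ℝ {S.F x, pd du S.F x, pd dv S.F x, G x})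

/-- the sphere-planes congruence `P = C + ⟨w⟩` of `Λ` and `Λ̂ = ⟨G⟩` with
respect to `w`. -/
def spherePlanes (n : ℕ) (S : IsothermicSurface n) (G : Surf → MV n)
    (w : MV n) (x : Surf) : Submodule ℝ (MV n) :=
  sphericalSystem n S G x ⊔ Submodule.span ℝ {w}

section Calculus

variable {E : Type*} [NormedAddCommGroup E] [NormedSpace ℝ E]

lemma smooth_fderiv_apply {f : Surf → E} (hf : ContDiff ℝ (⊤ : ℕ∞) f) (e : Surf) :
    ContDiff ℝ (⊤ : ℕ∞) (fun x => fderiv ℝ f x e) :=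
  (hf.fderiv_right (m := (⊤ : ℕ∞)) (by simp)).clm_apply contDiff_const

lemma smooth_differentiableAt {f : Surf → E} (hf : ContDiff ℝ (⊤ : ℕ∞) f) (x : Surf) :
    DifferentiableAt ℝ f x :=
  (hf.differentiable (by simp)) x

lemma fderiv_fderiv_comm {f : Surf → E} (hf : ContDiff ℝ (⊤ : ℕ∞) f) (x e e' : Surf) :
    fderiv ℝ (fun y => fderiv ℝ f y e) x e' = fderiv ℝ (fun y => fderiv ℝ f y e') x e := by
  have hd : DifferentiableAt ℝ (fderiv ℝ f) x :=
    ((hf.fderiv_right (m := (⊤ : ℕ∞)) (by simp)).differentiable (by simp)) x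
  have key : ∀ e e' : Surf, fderiv ℝ (fun y => fderiv ℝ f y e) x e'
      = fderiv ℝ (fderiv ℝ f) x e' e := by
    intro e e'
    rw [fderiv_clm_apply hd (differentiableAt_const e)]
    simp
  have hs : IsSymmSndFDerivAt ℝ f x :=
    hf.contDiffAt.isSymmSndFDerivAt (by
      simpa using WithTop.coe_le_coe.2 (le_top : (2 : ℕ∞) ≤ ⊤))
  rw [key, key]
  exact hs.eq e' e

lemma eq_du_dv (e : Surf) : e = e.1 • du + e.2 • dv := by
  ext <;> simp [du, dv]

lemma clm_eq_zero {L : Surf →L[ℝ] E} (hu : L du = 0) (hv : L dv = 0) : L = 0 := by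
  refine ContinuousLinearMap.ext fun e => ?_
  rw [eq_du_dv e]
  simp [hu, hv]

lemma eq_of_partials_eq_zero {f : Surf → E} (hf : ContDiff ℝ (⊤ : ℕ∞) f)
    (hu : ∀ x, fderiv ℝ f x du = 0) (hv : ∀ x, fderiv ℝ f x dv = 0) (x y : Surf) :
    f x = f y :=
  is_const_of_fderiv_eq_zero (hf.differentiable (by simp))
    (fun z => clm_eq_zero (hu z) (hv z)) x y

end Calculus

section VectorFields

/-- The derivative of a function along the vector field `p ∂/∂u + q ∂/∂v`. -/
def vfd (p q f : Surf → ℝ) (x : Surf) : ℝ := p x * pdR du f x + q x * pdR dv f x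

lemma smooth_pdR {f : Surf → ℝ} (hf : ContDiff ℝ (⊤ : ℕ∞) f) (e : Surf) :
    ContDiff ℝ (⊤ : ℕ∞) (pdR e f) := smooth_fderiv_apply hf e

lemma smooth_vfd {p q f : Surf → ℝ} (hp : ContDiff ℝ (⊤ : ℕ∞) p)
    (hq : ContDiff ℝ (⊤ : ℕ∞) q) (hf : ContDiff ℝ (⊤ : ℕ∞) f) :
    ContDiff ℝ (⊤ : ℕ∞) (vfd p q f) :=
  (hp.mul (smooth_pdR hf du)).add (hq.mul (smooth_pdR hf dv))

lemma pdR_add {f g : Surf → ℝ} (hf : ContDiff ℝ (⊤ : ℕ∞) f)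
    (hg : ContDiff ℝ (⊤ : ℕ∞) g) (e x : Surf) :
    pdR e (fun y => f y + g y) x = pdR e f x + pdR e g x := by
  simp [pdR, fderiv_fun_add (smooth_differentiableAt hf x) (smooth_differentiableAt hg x)]

lemma pdR_mul {f g : Surf → ℝ} (hf : ContDiff ℝ (⊤ : ℕ∞) f)
    (hg : ContDiff ℝ (⊤ : ℕ∞) g) (e x : Surf) :
    pdR e (fun y => f y * g y) x = pdR e f x * g x + f x * pdR e g x := by
  simp [pdR, fderiv_fun_mul (smooth_differentiableAt hf x) (smooth_differentiableAt hg x)]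
  ring

lemma pdR_const (c : ℝ) (e x : Surf) : pdR e (fun _ => c) x = 0 := by
  simp [pdR]

lemma pdR_exp {f : Surf → ℝ} (hf : ContDiff ℝ (⊤ : ℕ∞) f) (e x : Surf) :
    pdR e (fun y => Real.exp (f y)) x = Real.exp (f x) * pdR e f x := by
  simp [pdR, fderiv_exp (smooth_differentiableAt hf x)]

lemma vfd_add {p q f g : Surf → ℝ} (hf : ContDiff ℝ (⊤ : ℕ∞) f)
    (hg : ContDiff ℝ (⊤ : ℕ∞) g) (x : Surf) :
    vfd p q (fun y => f y + g y) x = vfd p q f x + vfd p q g x := by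
  simp only [vfd, pdR_add hf hg]; ring

lemma vfd_mul {p q f g : Surf → ℝ} (hf : ContDiff ℝ (⊤ : ℕ∞) f)
    (hg : ContDiff ℝ (⊤ : ℕ∞) g) (x : Surf) :
    vfd p q (fun y => f y * g y) x = vfd p q f x * g x + f x * vfd p q g x := by
  simp only [vfd, pdR_mul hf hg]; ring

lemma vfd_const (p q : Surf → ℝ) (c : ℝ) (x : Surf) : vfd p q (fun _ => c) x = 0 := by
  simp [vfd, pdR_const]

lemma vfd_const_mul {p q f : Surf → ℝ} (c : ℝ) (hf : ContDiff ℝ (⊤ : ℕ∞) f) (x : Surf) :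
    vfd p q (fun y => c * f y) x = c * vfd p q f x := by
  rw [vfd_mul contDiff_const hf, vfd_const]; ring

lemma vfd_exp {p q f : Surf → ℝ} (hf : ContDiff ℝ (⊤ : ℕ∞) f) (x : Surf) :
    vfd p q (fun y => Real.exp (f y)) x = Real.exp (f x) * vfd p q f x := by
  simp only [vfd, pdR_exp hf]; ring

lemma vfd_vfd_exp {p q f : Surf → ℝ} (hp : ContDiff ℝ (⊤ : ℕ∞) p)
    (hq : ContDiff ℝ (⊤ : ℕ∞) q) (hf : ContDiff ℝ (⊤ : ℕ∞) f) (x : Surf) :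
    vfd p q (vfd p q (fun y => Real.exp (f y))) x
      = Real.exp (f x) * (vfd p q f x ^ 2 + vfd p q (vfd p q f) x) := by
  have h : vfd p q (fun y => Real.exp (f y)) = fun y => Real.exp (f y) * vfd p q f y :=
    funext fun y => vfd_exp hf y
  rw [h, vfd_mul hf.exp (smooth_vfd hp hq hf), vfd_exp hf]
  ring

lemma vfd_vfd_mul {p q f g : Surf → ℝ} (hp : ContDiff ℝ (⊤ : ℕ∞) p)
    (hq : ContDiff ℝ (⊤ : ℕ∞) q) (hf : ContDiff ℝ (⊤ : ℕ∞) f)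
    (hg : ContDiff ℝ (⊤ : ℕ∞) g) (x : Surf) :
    vfd p q (vfd p q (fun y => f y * g y)) x
      = vfd p q (vfd p q f) x * g x + 2 * (vfd p q f x * vfd p q g x)
        + f x * vfd p q (vfd p q g) x := by
  have h : vfd p q (fun y => f y * g y)
      = fun y => vfd p q f y * g y + f y * vfd p q g y :=
    funext fun y => vfd_mul hf hg y
  have hf' := smooth_vfd hp hq hf
  have hg' := smooth_vfd hp hq hg
  rw [h, vfd_add (hf'.mul hg) (hf.mul hg'), vfd_mul hf' hg, vfd_mul hf hg']
  ring

lemma vfd_vfd_const_mul {p q f : Surf → ℝ} (hp : ContDiff ℝ (⊤ : ℕ∞) p)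
    (hq : ContDiff ℝ (⊤ : ℕ∞) q) (c : ℝ) (hf : ContDiff ℝ (⊤ : ℕ∞) f) (x : Surf) :
    vfd p q (vfd p q (fun y => c * f y)) x = c * vfd p q (vfd p q f) x := by
  have h : vfd p q (fun y => c * f y) = fun y => c * vfd p q f y :=
    funext fun y => vfd_const_mul c hf y
  rw [h, vfd_const_mul c (smooth_vfd hp hq hf)]

lemma pdR_eq_zero_of_isLocalMax {f : Surf → ℝ} {x : Surf} (h : IsLocalMax f x) (e : Surf) :
    pdR e f x = 0 := by
  simp [pdR, h.fderiv_eq_zero]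

lemma vfd_eq_zero_of_isLocalMax {p q f : Surf → ℝ} {x : Surf} (h : IsLocalMax f x) :
    vfd p q f x = 0 := by
  simp [vfd, pdR_eq_zero_of_isLocalMax h]

lemma deriv_deriv_nonpos_of_isLocalMax {g : ℝ → ℝ} {t : ℝ} (hg : ContinuousAt g t)
    (h : IsLocalMax g t) : deriv (deriv g) t ≤ 0 := by
  by_contra! hpos
  have hmin : IsLocalMin g t := isLocalMin_of_deriv_deriv_pos hpos h.deriv_eq_zero hg
  have hconst : g =ᶠ[nhds t] fun _ => g t := by
    filter_upwards [h, hmin] with s h1 h2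
    exact le_antisymm h1 h2
  have h2 : deriv (deriv g) t = 0 := by
    rw [hconst.deriv.deriv_eq]; simp
  exact absurd h2 hpos.ne'

lemma pdR_pdR_nonpos_of_isLocalMax {f : Surf → ℝ} (hf : ContDiff ℝ (⊤ : ℕ∞) f) {x : Surf}
    (h : IsLocalMax f x) (e : Surf) : pdR e (pdR e f) x ≤ 0 := by
  have hline : ∀ t : ℝ, HasDerivAt (fun t : ℝ => x + t • e) e t := by
    intro t
    simpa using ((hasDerivAt_id t).smul_const e).const_add x
  have hderiv : ∀ {k : Surf → ℝ}, ContDiff ℝ (⊤ : ℕ∞) k → ∀ t : ℝ,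
      HasDerivAt (fun t : ℝ => k (x + t • e)) (pdR e k (x + t • e)) t := by
    intro k hk t
    exact (smooth_differentiableAt hk _).hasFDerivAt.comp_hasDerivAt t (hline t)
  have h1 : deriv (fun t : ℝ => f (x + t • e)) = fun t => pdR e f (x + t • e) :=
    funext fun t => (hderiv hf t).deriv
  have h2 : deriv (deriv (fun t : ℝ => f (x + t • e))) 0 = pdR e (pdR e f) x := by
    rw [h1, (hderiv (smooth_pdR hf e) 0).deriv]; simp
  rw [← h2]
  have hx : x + (0 : ℝ) • e = x := by simp
  refine deriv_deriv_nonpos_of_isLocalMax (hderiv hf 0).continuousAt ?_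
  refine IsLocalMax.comp_continuous (g := fun t : ℝ => x + t • e) ?_ (hline 0).continuousAt
  rwa [hx]

lemma vfd_vfd_nonpos_of_isLocalMax {p q f : Surf → ℝ} (hp : ContDiff ℝ (⊤ : ℕ∞) p)
    (hq : ContDiff ℝ (⊤ : ℕ∞) q) (hf : ContDiff ℝ (⊤ : ℕ∞) f) {x : Surf}
    (h : IsLocalMax f x) : vfd p q (vfd p q f) x ≤ 0 := by
  have hu := smooth_pdR hf du
  have hv := smooth_pdR hf dv
  have hlin : pdR (p x • du + q x • dv) f = fun y => p x * pdR du f y + q x * pdR dv f y := by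
    funext y; simp [pdR]
  have key : vfd p q (vfd p q f) x
      = pdR (p x • du + q x • dv) (pdR (p x • du + q x • dv) f) x := by
    have hs : ∀ k : Surf → ℝ, pdR (p x • du + q x • dv) k x
        = p x * pdR du k x + q x * pdR dv k x := by
      intro k; simp [pdR]
    rw [hs, hlin]
    have e1 : ∀ e, pdR e (vfd p q f) x = p x * pdR e (pdR du f) x + q x * pdR e (pdR dv f) x := by
      intro e
      change pdR e (fun y => p y * pdR du f y + q y * pdR dv f y) x = _
      rw [pdR_add (hp.mul hu) (hq.mul hv), pdR_mul hp hu, pdR_mul hq hv,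
        pdR_eq_zero_of_isLocalMax h, pdR_eq_zero_of_isLocalMax h]
      ring
    have e2 : ∀ e, pdR e (fun y => p x * pdR du f y + q x * pdR dv f y) x
        = p x * pdR e (pdR du f) x + q x * pdR e (pdR dv f) x := by
      intro e
      rw [pdR_add (contDiff_const.mul hu) (contDiff_const.mul hv), pdR_mul contDiff_const hu,
        pdR_mul contDiff_const hv, pdR_const, pdR_const]
      ring
    rw [e2, e2, vfd, e1, e1]
  rw [key]
  exact pdR_pdR_nonpos_of_isLocalMax hf h _

end VectorFields

section UniqueContinuation

lemma vfd_commutator {m r γ k : Surf → ℝ} (hm : ContDiff ℝ (⊤ : ℕ∞) m)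
    (hr : ContDiff ℝ (⊤ : ℕ∞) r) (hk : ContDiff ℝ (⊤ : ℕ∞) k)
    (hγ : ∀ z, γ z * r z = vfd (fun _ => 1) m r z - vfd (fun _ => 0) r m z) (z : Surf) :
    vfd (fun _ => 1) m (vfd (fun _ => 0) r k) z
      = vfd (fun _ => 0) r (vfd (fun _ => 1) m k) z + γ z * vfd (fun _ => 0) r k z := by
  have hu := smooth_pdR hk du
  have hv := smooth_pdR hk dv
  have hB : vfd (fun _ => 0) r k = fun y => r y * pdR dv k y := by
    funext y; simp [vfd]
  have hA : vfd (fun _ => 1) m k = fun y => pdR du k y + m y * pdR dv k y := by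
    funext y; simp [vfd]
  have hcomm : pdR du (pdR dv k) z = pdR dv (pdR du k) z := fderiv_fderiv_comm hk z dv du
  rw [hB, hA, vfd_mul hr hv, vfd_add hu (hm.mul hv), vfd_mul hm hv]
  have h := hγ z
  simp only [vfd] at h ⊢
  rw [hcomm]
  linear_combination pdR dv k z * h.symm

/-- The equations satisfied by the real and imaginary parts of a solution of a first-order
elliptic complex-linear equation, in terms of the frame `∂/∂u + m ∂/∂v`, `r ∂/∂v`. -/
structure CauchyRiemannSystem (m r γ x y : Surf → ℝ) : Prop where
  smooth_m : ContDiff ℝ (⊤ : ℕ∞) m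
  smooth_r : ContDiff ℝ (⊤ : ℕ∞) r
  smooth_γ : ContDiff ℝ (⊤ : ℕ∞) γ
  smooth_x : ContDiff ℝ (⊤ : ℕ∞) x
  smooth_y : ContDiff ℝ (⊤ : ℕ∞) y
  r_ne : ∀ z, r z ≠ 0
  bracket : ∀ z, γ z * r z = vfd (fun _ => 1) m r z - vfd (fun _ => 0) r m z
  eq_x : ∀ z, vfd (fun _ => 1) m x z = 2 * (γ z * x z) - vfd (fun _ => 0) r y z
  eq_y : ∀ z, vfd (fun _ => 1) m y z = 2 * (γ z * y z) + vfd (fun _ => 0) r x z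

namespace CauchyRiemannSystem

variable {m r γ x y : Surf → ℝ}

/-- The logarithm of the squared modulus of a solution solves an elliptic equation. -/
lemma normSq_identity (h : CauchyRiemannSystem m r γ x y) (z : Surf) :
    let φ : Surf → ℝ := fun z => x z * x z + y z * y z
    φ z * (vfd (fun _ => 1) m (vfd (fun _ => 1) m φ) z
        + vfd (fun _ => 0) r (vfd (fun _ => 0) r φ) z)
      = vfd (fun _ => 1) m φ z ^ 2 + vfd (fun _ => 0) r φ z ^ 2
        + γ z * φ z * vfd (fun _ => 1) m φ z
        + φ z ^ 2 * (4 * vfd (fun _ => 1) m γ z - 4 * γ z ^ 2) := by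
  intro φ
  have h1 : ContDiff ℝ (⊤ : ℕ∞) (fun _ : Surf => (1 : ℝ)) := contDiff_const
  have h0 : ContDiff ℝ (⊤ : ℕ∞) (fun _ : Surf => (0 : ℝ)) := contDiff_const
  have hx := h.smooth_x
  have hy := h.smooth_y
  have hxx := hx.mul hx
  have hyy := hy.mul hy
  have hBx := smooth_vfd h0 h.smooth_r hx
  have hBy := smooth_vfd h0 h.smooth_r hy
  have hAx : vfd (fun _ => 1) m x
      = fun z => 2 * (γ z * x z) + (-1) * vfd (fun _ => 0) r y z := by
    funext z; rw [h.eq_x]; ring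
  have hAy : vfd (fun _ => 1) m y = fun z => 2 * (γ z * y z) + vfd (fun _ => 0) r x z := by
    funext z; rw [h.eq_y]
  have hcx := vfd_commutator h.smooth_m h.smooth_r hx h.bracket z
  have hcy := vfd_commutator h.smooth_m h.smooth_r hy h.bracket z
  have hγx := h.smooth_γ.mul hx
  have hγy := h.smooth_γ.mul hy
  have hAAx : vfd (fun _ => 1) m (vfd (fun _ => 1) m x) z
      = 2 * (vfd (fun _ => 1) m γ z * x z + γ z * vfd (fun _ => 1) m x z)
        - vfd (fun _ => 1) m (vfd (fun _ => 0) r y) z := by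
    nth_rewrite 1 [hAx]
    rw [vfd_add (contDiff_const.mul hγx) (contDiff_const.mul hBy), vfd_const_mul _ hγx,
      vfd_const_mul _ hBy, vfd_mul h.smooth_γ hx]
    ring
  have hAAy : vfd (fun _ => 1) m (vfd (fun _ => 1) m y) z
      = 2 * (vfd (fun _ => 1) m γ z * y z + γ z * vfd (fun _ => 1) m y z)
        + vfd (fun _ => 1) m (vfd (fun _ => 0) r x) z := by
    nth_rewrite 1 [hAy]
    rw [vfd_add (contDiff_const.mul hγy) hBx, vfd_const_mul _ hγy, vfd_mul h.smooth_γ hy]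
  have hBAx : vfd (fun _ => 0) r (vfd (fun _ => 1) m x) z
      = 2 * (vfd (fun _ => 0) r γ z * x z + γ z * vfd (fun _ => 0) r x z)
        - vfd (fun _ => 0) r (vfd (fun _ => 0) r y) z := by
    rw [hAx, vfd_add (contDiff_const.mul hγx) (contDiff_const.mul hBy), vfd_const_mul _ hγx,
      vfd_const_mul _ hBy, vfd_mul h.smooth_γ hx]
    ring
  have hBAy : vfd (fun _ => 0) r (vfd (fun _ => 1) m y) z
      = 2 * (vfd (fun _ => 0) r γ z * y z + γ z * vfd (fun _ => 0) r y z)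
        + vfd (fun _ => 0) r (vfd (fun _ => 0) r x) z := by
    rw [hAy, vfd_add (contDiff_const.mul hγy) hBx, vfd_const_mul _ hγy, vfd_mul h.smooth_γ hy]
  have hA1 : vfd (fun _ => 1) m φ z
      = 2 * (x z * vfd (fun _ => 1) m x z + y z * vfd (fun _ => 1) m y z) := by
    rw [vfd_add hxx hyy, vfd_mul hx hx, vfd_mul hy hy]; ring
  have hB1 : vfd (fun _ => 0) r φ z
      = 2 * (x z * vfd (fun _ => 0) r x z + y z * vfd (fun _ => 0) r y z) := by
    rw [vfd_add hxx hyy, vfd_mul hx hx, vfd_mul hy hy]; ring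
  have hsnd : ∀ {p q : Surf → ℝ}, ContDiff ℝ (⊤ : ℕ∞) p → ContDiff ℝ (⊤ : ℕ∞) q →
      vfd p q (vfd p q φ) z = 2 * (x z * vfd p q (vfd p q x) z + y z * vfd p q (vfd p q y) z
        + vfd p q x z ^ 2 + vfd p q y z ^ 2) := by
    intro p q hp hq
    have : vfd p q φ = fun z => vfd p q (fun w => x w * x w) z + vfd p q (fun w => y w * y w) z :=
      funext fun w => vfd_add hxx hyy w
    rw [this, vfd_add (smooth_vfd hp hq hxx) (smooth_vfd hp hq hyy), vfd_vfd_mul hp hq hx hx,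
      vfd_vfd_mul hp hq hy hy]
    ring
  rw [hsnd h1 h.smooth_m, hsnd h0 h.smooth_r, hA1, hB1, hAAx, hAAy, hcx, hcy, hBAx, hBAy,
    h.eq_x, h.eq_y]
  simp only [φ]
  ring

/-- At an interior maximum of `|q|² e^b` with `q ≠ 0`, the weight `b` is not a strict
subsolution. -/
lemma weight_le_of_isLocalMax (h : CauchyRiemannSystem m r γ x y) {b : Surf → ℝ}
    (hb : ContDiff ℝ (⊤ : ℕ∞) b) {z : Surf} (hz : 0 < x z * x z + y z * y z)
    (hmax : IsLocalMax (fun z => (x z * x z + y z * y z) * Real.exp (b z)) z) :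
    vfd (fun _ => 1) m (vfd (fun _ => 1) m b) z + vfd (fun _ => 0) r (vfd (fun _ => 0) r b) z
      - γ z * vfd (fun _ => 1) m b z + (4 * vfd (fun _ => 1) m γ z - 4 * γ z ^ 2) ≤ 0 := by
  have h1 : ContDiff ℝ (⊤ : ℕ∞) (fun _ : Surf => (1 : ℝ)) := contDiff_const
  have h0 : ContDiff ℝ (⊤ : ℕ∞) (fun _ : Surf => (0 : ℝ)) := contDiff_const
  have hid := h.normSq_identity z
  have hφ : ContDiff ℝ (⊤ : ℕ∞) (fun z => x z * x z + y z * y z) :=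
    (h.smooth_x.mul h.smooth_x).add (h.smooth_y.mul h.smooth_y)
  simp only at hid
  set φ : Surf → ℝ := fun z => x z * x z + y z * y z with hφdef
  have hψ := hφ.mul hb.exp
  have gA := vfd_eq_zero_of_isLocalMax (p := fun _ => 1) (q := m) hmax
  have gB := vfd_eq_zero_of_isLocalMax (p := fun _ => 0) (q := r) hmax
  have sA := vfd_vfd_nonpos_of_isLocalMax h1 h.smooth_m hψ hmax
  have sB := vfd_vfd_nonpos_of_isLocalMax h0 h.smooth_r hψ hmax
  change vfd _ _ (fun z => φ z * Real.exp (b z)) z = 0 at gA gB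
  rw [vfd_mul hφ hb.exp, vfd_exp hb] at gA gB
  rw [vfd_vfd_mul h1 h.smooth_m hφ hb.exp, vfd_vfd_exp h1 h.smooth_m hb, vfd_exp hb] at sA
  rw [vfd_vfd_mul h0 h.smooth_r hφ hb.exp, vfd_vfd_exp h0 h.smooth_r hb, vfd_exp hb] at sB
  have he := Real.exp_pos (b z)
  have hφz : x z * x z + y z * y z = φ z := rfl
  rw [hφz] at hz hid
  generalize Real.exp (b z) = e at *
  have dA : vfd (fun _ => 1) m φ z = - φ z * vfd (fun _ => 1) m b z :=
    mul_left_cancel₀ he.ne' (by linear_combination gA)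
  have dB : vfd (fun _ => 0) r φ z = - φ z * vfd (fun _ => 0) r b z :=
    mul_left_cancel₀ he.ne' (by linear_combination gB)
  rw [dA] at sA hid
  rw [dB] at sB hid
  generalize vfd (fun _ => 1) m (vfd (fun _ => 1) m φ) z = AAφ at *
  generalize vfd (fun _ => 0) r (vfd (fun _ => 0) r φ) z = BBφ at *
  generalize vfd (fun _ => 1) m (vfd (fun _ => 1) m b) z = AAb at *
  generalize vfd (fun _ => 0) r (vfd (fun _ => 0) r b) z = BBb at *
  generalize vfd (fun _ => 1) m b z = Ab at *
  generalize vfd (fun _ => 0) r b z = Bb at *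
  generalize vfd (fun _ => 1) m γ z = Aγ at *
  generalize φ z = P at *
  by_contra! hpos
  have hprod : 0 < P ^ 2 * e * (AAb + BBb - γ z * Ab + (4 * Aγ - 4 * γ z ^ 2)) := by positivity
  have hsum := mul_nonpos_of_nonneg_of_nonpos hz.le (add_nonpos sA sB)
  have : P * (AAφ * e + 2 * (-P * Ab * (e * Ab)) + P * (e * (Ab ^ 2 + AAb)) +
      (BBφ * e + 2 * (-P * Bb * (e * Bb)) + P * (e * (Bb ^ 2 + BBb))))
      = P ^ 2 * e * (AAb + BBb - γ z * Ab + (4 * Aγ - 4 * γ z ^ 2)) := by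
    linear_combination e * hid
  linarith

/-- Weak unique continuation for Cauchy-Riemann systems. -/
theorem eq_zero_of_eventually_eq_zero (h : CauchyRiemannSystem m r γ x y) {z₀ : Surf}
    (hz₀ : ∀ᶠ z in nhds z₀, x z = 0 ∧ y z = 0) (z₁ : Surf) : x z₁ = 0 ∧ y z₁ = 0 := by
  have h1 : ContDiff ℝ (⊤ : ℕ∞) (fun _ : Surf => (1 : ℝ)) := contDiff_const
  have h0 : ContDiff ℝ (⊤ : ℕ∞) (fun _ : Surf => (0 : ℝ)) := contDiff_const
  have hm := h.smooth_m
  have hr := h.smooth_r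
  have hφ : ContDiff ℝ (⊤ : ℕ∞) (fun z => x z * x z + y z * y z) :=
    (h.smooth_x.mul h.smooth_x).add (h.smooth_y.mul h.smooth_y)
  set φ : Surf → ℝ := fun z => x z * x z + y z * y z with hφdef
  suffices hφ₁ : ¬ 0 < φ z₁ by
    constructor <;> nlinarith [mul_self_nonneg (x z₁), mul_self_nonneg (y z₁)]
  intro hφ₁
  set ρ : Surf → ℝ := fun z => (z.1 - z₀.1) ^ 2 + (z.2 - z₀.2) ^ 2 with hρdef
  have hρ : ContDiff ℝ (⊤ : ℕ∞) ρ := by fun_prop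
  have hρd : ∀ z, HasFDerivAt ρ ((2 * (z.1 - z₀.1)) • ContinuousLinearMap.fst ℝ ℝ ℝ
      + (2 * (z.2 - z₀.2)) • ContinuousLinearMap.snd ℝ ℝ ℝ) z := by
    intro z
    have h2 := ((hasFDerivAt_fst (𝕜 := ℝ) (p := z)).sub_const z₀.1 |>.pow 2).fun_add
      ((hasFDerivAt_snd (𝕜 := ℝ) (p := z)).sub_const z₀.2 |>.pow 2)
    simp only [Nat.add_one_sub_one, pow_one, Nat.cast_ofNat, nsmul_eq_mul] at h2
    exact h2
  have hρu : ∀ z, pdR du ρ z = 2 * (z.1 - z₀.1) := fun z => by simp [pdR, (hρd z).fderiv, du]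
  have hρv : ∀ z, pdR dv ρ z = 2 * (z.2 - z₀.2) := fun z => by simp [pdR, (hρd z).fderiv, dv]
  obtain ⟨r₀, hr₀, hball⟩ : ∃ r₀ > 0, ∀ z, ρ z ≤ r₀ → φ z = 0 := by
    obtain ⟨ε, hε, hb⟩ := Metric.eventually_nhds_iff.1 hz₀
    refine ⟨(ε / 2) ^ 2, by positivity, fun z hz => ?_⟩
    have hd : dist z z₀ < ε := by
      simp only [hρdef] at hz
      rw [Prod.dist_eq, max_lt_iff, Real.dist_eq, Real.dist_eq]
      constructor <;> refine lt_of_le_of_lt (abs_le_of_sq_le_sq ?_ (by positivity)) (half_lt_self hε)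
      · nlinarith [sq_nonneg (z.2 - z₀.2)]
      · nlinarith [sq_nonneg (z.1 - z₀.1)]
    simp [hφdef, hb hd]
  have hρ₁ : r₀ < ρ z₁ := by
    by_contra! hle
    exact hφ₁.ne' (hball z₁ hle)
  set R : ℝ := ρ z₁ + 1 with hR
  set K : Set Surf := {z | r₀ ≤ ρ z ∧ ρ z ≤ R} with hKdef
  have hK₁ : z₁ ∈ K := ⟨hρ₁.le, by linarith⟩
  have hK : IsCompact K := by
    refine Metric.isCompact_of_isClosed_isBounded ?_ ?_
    · exact (isClosed_le continuous_const hρ.continuous).inter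
        (isClosed_le hρ.continuous continuous_const)
    · refine (Metric.isBounded_closedBall (x := z₀) (r := R + 1)).subset fun z hz => ?_
      have h2 := hz.2
      simp only [hρdef] at h2
      have hRpos : 0 < R := by linarith
      rw [Metric.mem_closedBall, Prod.dist_eq, max_le_iff, Real.dist_eq, Real.dist_eq]
      constructor <;> refine abs_le_of_sq_le_sq ?_ (by positivity)
      · nlinarith [sq_nonneg (z.2 - z₀.2)]
      · nlinarith [sq_nonneg (z.1 - z₀.1)]
  have hAρ := smooth_vfd h1 hm hρ
  have hBρ := smooth_vfd h0 hr hρ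
  set g : Surf → ℝ := fun z => vfd (fun _ => 1) m ρ z ^ 2 + vfd (fun _ => 0) r ρ z ^ 2 with hgdef
  have hg : Continuous g := ((hAρ.pow 2).add (hBρ.pow 2)).continuous
  obtain ⟨z₂, hz₂, hmin⟩ := hK.exists_isMinOn ⟨z₁, hK₁⟩ hg.continuousOn
  have hc₁ : 0 < g z₂ := by
    by_contra! hle
    have e1 : vfd (fun _ => 1) m ρ z₂ = 0 := by
      simp only [hgdef] at hle
      nlinarith [sq_nonneg (vfd (fun _ => 1) m ρ z₂), sq_nonneg (vfd (fun _ => 0) r ρ z₂)]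
    have e2 : vfd (fun _ => 0) r ρ z₂ = 0 := by
      simp only [hgdef] at hle
      nlinarith [sq_nonneg (vfd (fun _ => 1) m ρ z₂), sq_nonneg (vfd (fun _ => 0) r ρ z₂)]
    simp only [vfd, hρu, hρv] at e1 e2
    have e3 : z₂.2 - z₀.2 = 0 := by simpa [h.r_ne z₂] using e2
    rw [e3] at e1
    have e4 : z₂.1 - z₀.1 = 0 := by simpa using e1
    have := hz₂.1
    simp only [hρdef, e3, e4] at this
    norm_num at this
    linarith
  set c₁ := g z₂
  obtain ⟨C₂, hC₂⟩ := hK.exists_bound_of_continuousOn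
    (f := fun z => vfd (fun _ => 1) m (vfd (fun _ => 1) m ρ) z
      + vfd (fun _ => 0) r (vfd (fun _ => 0) r ρ) z - γ z * vfd (fun _ => 1) m ρ z)
    (((smooth_vfd h1 hm hAρ).add (smooth_vfd h0 hr hBρ)).sub
      (h.smooth_γ.mul hAρ)).continuous.continuousOn
  obtain ⟨C₃, hC₃⟩ := hK.exists_bound_of_continuousOn
    (f := fun z => 4 * vfd (fun _ => 1) m γ z - 4 * γ z ^ 2)
    ((contDiff_const.mul (smooth_vfd h1 hm h.smooth_γ)).sub
      (contDiff_const.mul (h.smooth_γ.pow 2))).continuous.continuousOn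
  obtain ⟨M, hM⟩ := hK.exists_bound_of_continuousOn (f := φ) hφ.continuous.continuousOn
  have hC₂0 : 0 ≤ C₂ := (norm_nonneg _).trans (hC₂ z₁ hK₁)
  set α : ℝ := (C₂ + 1) / c₁ + 1 with hα
  have hα1 : 1 ≤ α := by
    have : 0 ≤ (C₂ + 1) / c₁ := by positivity
    linarith
  have hαc : C₂ + 1 ≤ α * c₁ := by
    have : (C₂ + 1) / c₁ * c₁ = C₂ + 1 := div_mul_cancel₀ _ hc₁.ne'
    rw [hα]; nlinarith
  set β : Surf → ℝ := fun z => Real.exp (-α * ρ z) with hβdef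
  have hαρ : ContDiff ℝ (⊤ : ℕ∞) (fun z => -α * ρ z) := contDiff_const.mul hρ
  have hβ : ContDiff ℝ (⊤ : ℕ∞) β := hαρ.exp
  set βR : ℝ := Real.exp (-α * R) with hβR
  have hβRpos : 0 < βR := Real.exp_pos _
  have hLβ : ∀ z ∈ K, βR ≤ vfd (fun _ => 1) m (vfd (fun _ => 1) m β) z
      + vfd (fun _ => 0) r (vfd (fun _ => 0) r β) z - γ z * vfd (fun _ => 1) m β z := by
    intro z hz
    have hβz : βR ≤ β z := Real.exp_le_exp.2 (by nlinarith [hz.2])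
    refine hβz.trans ?_
    rw [vfd_vfd_exp h1 hm hαρ, vfd_vfd_exp h0 hr hαρ, vfd_exp hαρ,
      vfd_vfd_const_mul h1 hm _ hρ, vfd_vfd_const_mul h0 hr _ hρ, vfd_const_mul _ hρ,
      vfd_const_mul _ hρ]
    have k1 : c₁ ≤ g z := hmin hz
    have k2 := (abs_le.1 (hC₂ z hz)).2
    have hβ0 : 0 < β z := Real.exp_pos _
    change β z ≤ β z * _ + β z * _ - γ z * (β z * _)
    simp only [hgdef] at k1
    generalize vfd (fun _ => 1) m (vfd (fun _ => 1) m ρ) z = AA at *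
    generalize vfd (fun _ => 0) r (vfd (fun _ => 0) r ρ) z = BB at *
    generalize vfd (fun _ => 1) m ρ z = a at *
    generalize vfd (fun _ => 0) r ρ z = b at *
    have k3 : α * c₁ ≤ α * (a ^ 2 + b ^ 2) := by gcongr
    have k4 : 1 ≤ α * (α * (a ^ 2 + b ^ 2) - (AA + BB - γ z * a)) := by nlinarith
    nlinarith
  have hβ₁ : βR < β z₁ := Real.exp_lt_exp.2 (by nlinarith)
  obtain ⟨l, hl1, hl2, hl0⟩ : ∃ l : ℝ, C₃ < l * βR ∧ M < l * (φ z₁ * (β z₁ - βR)) ∧ 0 < l := by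
    have t1 := (Filter.tendsto_id.atTop_mul_const hβRpos).eventually_gt_atTop C₃
    have t2 := (Filter.tendsto_id.atTop_mul_const
      (mul_pos hφ₁ (sub_pos.2 hβ₁))).eventually_gt_atTop M
    exact (t1.and (t2.and (Filter.eventually_gt_atTop 0))).exists
  have hlβ : ContDiff ℝ (⊤ : ℕ∞) (fun z => l * β z) := contDiff_const.mul hβ
  obtain ⟨p, hp, hpmax⟩ := hK.exists_isMaxOn ⟨z₁, hK₁⟩
    (f := fun z => φ z * Real.exp (l * β z)) (hφ.mul hlβ.exp).continuous.continuousOn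
  have hp₁ : φ z₁ * Real.exp (l * β z₁) ≤ φ p * Real.exp (l * β p) := hpmax hK₁
  have hφp : 0 < φ p := by
    have : 0 < φ p * Real.exp (l * β p) := lt_of_lt_of_le (by positivity) hp₁
    exact pos_of_mul_pos_left this (Real.exp_pos _).le
  have hpr : r₀ < ρ p := by
    by_contra! hle
    exact hφp.ne' (hball p hle)
  have hpR : ρ p < R := by
    refine lt_of_le_of_ne hp.2 fun heq => ?_
    have hβp : β p = βR := by simp only [hβdef, heq, hβR]
    rw [hβp] at hp₁
    have e1 : Real.exp (l * β z₁) = Real.exp (l * (β z₁ - βR)) * Real.exp (l * βR) := by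
      rw [← Real.exp_add]; congr 1; ring
    rw [e1, ← mul_assoc] at hp₁
    have e2 := le_of_mul_le_mul_right hp₁ (Real.exp_pos _)
    have e3 := Real.add_one_le_exp (l * (β z₁ - βR))
    have e4 := (abs_le.1 (hM p hp)).2
    nlinarith
  have hloc : IsLocalMax (fun z => (x z * x z + y z * y z) * Real.exp (l * β z)) p := by
    have : {z | r₀ < ρ z} ∩ {z | ρ z < R} ∈ nhds p :=
      ((isOpen_lt continuous_const hρ.continuous).inter
        (isOpen_lt hρ.continuous continuous_const)).mem_nhds ⟨hpr, hpR⟩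
    filter_upwards [this] with z hz
    exact hpmax ⟨hz.1.le, hz.2.le⟩
  have hfin := h.weight_le_of_isLocalMax hlβ hφp hloc
  rw [vfd_vfd_const_mul h1 hm _ hβ, vfd_vfd_const_mul h0 hr _ hβ, vfd_const_mul _ hβ] at hfin
  have f1 := hLβ p hp
  have f2 := (abs_le.1 (hC₃ p hp)).1
  nlinarith

end CauchyRiemannSystem

end UniqueContinuation

section MinkowskiCalculus

variable {n : ℕ}

lemma mink_comm (a b : MV n) : mink n a b = mink n b a := by
  simp [mink, mul_comm]

lemma mink_add_right (a b c : MV n) : mink n a (b + c) = mink n a b + mink n a c := by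
  rw [mink_comm, mink_add_left, mink_comm b, mink_comm c]

lemma mink_smul_right (r : ℝ) (a c : MV n) : mink n a (r • c) = r * mink n a c := by
  rw [mink_comm, mink_smul_left, mink_comm]

lemma mink_neg_left (a c : MV n) : mink n (-a) c = -mink n a c := by
  simpa using mink_smul_left n (-1) a c

lemma mink_neg_right (a c : MV n) : mink n a (-c) = -mink n a c := by
  simpa using mink_smul_right (-1) a c

lemma mink_sub_left (a b c : MV n) : mink n (a - b) c = mink n a c - mink n b c := by
  rw [sub_eq_add_neg, mink_add_left, mink_neg_left, sub_eq_add_neg]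

lemma mink_sub_right (a b c : MV n) : mink n a (b - c) = mink n a b - mink n a c := by
  rw [sub_eq_add_neg, mink_add_right, mink_neg_right, sub_eq_add_neg]

/-- The Minkowski form as a continuous bilinear map. -/
def minkCLM (n : ℕ) : MV n →L[ℝ] MV n →L[ℝ] ℝ :=
  LinearMap.toContinuousLinearMap ((LinearMap.toContinuousLinearMap :
    (MV n →ₗ[ℝ] ℝ) ≃ₗ[ℝ] (MV n →L[ℝ] ℝ)).toLinearMap ∘ₗ
      LinearMap.mk₂ ℝ (mink n) (mink_add_left n) (mink_smul_left n) mink_add_right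
        mink_smul_right)

lemma minkCLM_apply (a b : MV n) : minkCLM n a b = mink n a b := rfl

lemma smooth_mink {f g : Surf → MV n} (hf : ContDiff ℝ (⊤ : ℕ∞) f)
    (hg : ContDiff ℝ (⊤ : ℕ∞) g) : ContDiff ℝ (⊤ : ℕ∞) (fun y => mink n (f y) (g y)) :=
  (((minkCLM n).contDiff.comp hf).clm_apply hg)

lemma pdR_mink {f g : Surf → MV n} (hf : ContDiff ℝ (⊤ : ℕ∞) f)
    (hg : ContDiff ℝ (⊤ : ℕ∞) g) (e x : Surf) :
    pdR e (fun y => mink n (f y) (g y)) x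
      = mink n (pd e f x) (g x) + mink n (f x) (pd e g x) := by
  have h := (minkCLM n).fderiv_of_bilinear (smooth_differentiableAt hf x)
    (smooth_differentiableAt hg x)
  simp only [minkCLM_apply] at h
  simp [pdR, h, pd, minkCLM_apply, add_comm]

lemma smooth_pd {f : Surf → MV n} (hf : ContDiff ℝ (⊤ : ℕ∞) f) (e : Surf) :
    ContDiff ℝ (⊤ : ℕ∞) (pd e f) := smooth_fderiv_apply hf e

lemma pd_add {f g : Surf → MV n} (hf : ContDiff ℝ (⊤ : ℕ∞) f)
    (hg : ContDiff ℝ (⊤ : ℕ∞) g) (e x : Surf) :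
    pd e (fun y => f y + g y) x = pd e f x + pd e g x := by
  simp [pd, fderiv_fun_add (smooth_differentiableAt hf x) (smooth_differentiableAt hg x)]

lemma pd_sub {f g : Surf → MV n} (hf : ContDiff ℝ (⊤ : ℕ∞) f)
    (hg : ContDiff ℝ (⊤ : ℕ∞) g) (e x : Surf) :
    pd e (fun y => f y - g y) x = pd e f x - pd e g x := by
  simp [pd, fderiv_fun_sub (smooth_differentiableAt hf x) (smooth_differentiableAt hg x)]

lemma pd_smul {a : Surf → ℝ} {f : Surf → MV n} (ha : ContDiff ℝ (⊤ : ℕ∞) a)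
    (hf : ContDiff ℝ (⊤ : ℕ∞) f) (e x : Surf) :
    pd e (fun y => a y • f y) x = pdR e a x • f x + a x • pd e f x := by
  simp [pd, pdR, fderiv_fun_smul (smooth_differentiableAt ha x) (smooth_differentiableAt hf x),
    add_comm]

lemma pd_const_smul {f : Surf → MV n} (c : ℝ) (hf : ContDiff ℝ (⊤ : ℕ∞) f) (e x : Surf) :
    pd e (fun y => c • f y) x = c • pd e f x := by
  simp [pd_smul contDiff_const hf, pdR_const]

lemma mink_pd_eq_neg {f g : Surf → MV n} (hf : ContDiff ℝ (⊤ : ℕ∞) f)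
    (hg : ContDiff ℝ (⊤ : ℕ∞) g) {c : ℝ} (h : ∀ x, mink n (f x) (g x) = c) (e x : Surf) :
    mink n (pd e f x) (g x) = -mink n (f x) (pd e g x) := by
  have h2 := pdR_mink hf hg e x
  rw [show (fun y => mink n (f y) (g y)) = fun _ => c from funext h, pdR_const] at h2
  linarith

lemma mink_pd_const {f : Surf → MV n} (hf : ContDiff ℝ (⊤ : ℕ∞) f) {w : MV n} {c : ℝ}
    (h : ∀ x, mink n (f x) w = c) (e x : Surf) : mink n (pd e f x) w = 0 := by
  rw [mink_pd_eq_neg hf contDiff_const h]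
  rw [mink_comm]
  simp [pd, mink_zero_left]

/-- The derivative of a vector-valued function along `p ∂/∂u + q ∂/∂v`. -/
def vpd (p q : Surf → ℝ) (f : Surf → MV n) (x : Surf) : MV n :=
  p x • pd du f x + q x • pd dv f x

lemma vfd_mink {p q : Surf → ℝ} {f g : Surf → MV n} (hf : ContDiff ℝ (⊤ : ℕ∞) f)
    (hg : ContDiff ℝ (⊤ : ℕ∞) g) (x : Surf) :
    vfd p q (fun y => mink n (f y) (g y)) x
      = mink n (vpd p q f x) (g x) + mink n (f x) (vpd p q g x) := by
  simp only [vfd, vpd, pdR_mink hf hg, mink_add_left, mink_add_right, mink_smul_left,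
    mink_smul_right]
  ring

lemma vpd_closed {m r γ : Surf → ℝ} {X₁ X₂ : Surf → MV n} (hm : ContDiff ℝ (⊤ : ℕ∞) m)
    (hr : ContDiff ℝ (⊤ : ℕ∞) r) (h₁ : ContDiff ℝ (⊤ : ℕ∞) X₁)
    (h₂ : ContDiff ℝ (⊤ : ℕ∞) X₂) (hcl : ∀ x, pd du X₂ x = pd dv X₁ x)
    (hγ : ∀ z, γ z * r z = vfd (fun _ => 1) m r z - vfd (fun _ => 0) r m z) (z : Surf) :
    vpd (fun _ => 1) m (fun y => r y • X₂ y) z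
      = vpd (fun _ => 0) r (fun y => X₁ y + m y • X₂ y) z + γ z • (r z • X₂ z) := by
  have h := hγ z
  have hadd : ∀ e, pd e (fun y => X₁ y + m y • X₂ y) z
      = pd e X₁ z + (pdR e m z • X₂ z + m z • pd e X₂ z) := fun e =>
    (pd_add h₁ (hm.smul h₂) e z).trans (by rw [← pd_smul hm h₂]; rfl)
  simp only [vpd, vfd] at h ⊢
  rw [smul_smul, h, pd_smul hr h₂, pd_smul hr h₂, hadd, hadd, hcl]
  module

lemma mink_self_pos {F w v : MV n} (hF : mink n F F = 0) (hFw : mink n F w = -1)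
    (hvF : mink n v F = 0) (hvw : mink n v w = 0) (hv : v ≠ 0) : 0 < mink n v v := by
  set f := F (Fin.last (n + 1)) with hf
  set k := v (Fin.last (n + 1)) with hk
  have key : f ^ 2 * mink n v v
      = ∑ i : Fin (n + 1), (f * v i.castSucc - k * F i.castSucc) ^ 2 := by
    have e1 : ∑ i : Fin (n + 1), (f * v i.castSucc - k * F i.castSucc) ^ 2
        = f ^ 2 * mink n v v - 2 * (f * k) * mink n v F + k ^ 2 * mink n F F := by
      simp only [mink, ← hf, ← hk, mul_sub, Finset.mul_sum]
      have : ∀ a b c d e g : ℝ, a - b - (c - d) + (e - g) = (a - c + e) + (d - b - g) := by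
        intros; ring
      rw [this, ← Finset.sum_sub_distrib, ← Finset.sum_add_distrib]
      rw [show 2 * (f * k) * (k * f) - f ^ 2 * (k * k) - k ^ 2 * (f * f) = 0 by ring, add_zero]
      exact Finset.sum_congr rfl fun i _ => by ring
    rw [e1, hvF, hF]; ring
  have hf0 : f ≠ 0 := by
    intro h0
    have hs : ∑ i : Fin (n + 1), F i.castSucc * F i.castSucc = 0 := by
      simpa [mink, ← hf, h0] using hF
    have hz : ∀ i : Fin (n + 1), F i.castSucc = 0 := by
      intro i
      have := (Finset.sum_eq_zero_iff_of_nonneg (fun i _ => mul_self_nonneg _)).1 hs i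
        (Finset.mem_univ i)
      exact mul_self_eq_zero.1 this
    have : mink n F w = 0 := by simp [mink, hz, ← hf, h0]
    linarith
  have hf2 : 0 < f ^ 2 := by positivity
  have hnn : 0 ≤ f ^ 2 * mink n v v := by
    rw [key]; exact Finset.sum_nonneg fun i _ => sq_nonneg _
  refine lt_of_le_of_ne (nonneg_of_mul_nonneg_right hnn hf2) fun h0 => hv ?_
  rw [← h0, mul_zero, eq_comm] at key
  have hz : ∀ i : Fin (n + 1), f * v i.castSucc = k * F i.castSucc := by
    intro i
    have := (Finset.sum_eq_zero_iff_of_nonneg (fun i _ => sq_nonneg _)).1 key i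
      (Finset.mem_univ i)
    exact sub_eq_zero.1 (pow_eq_zero_iff (two_ne_zero)|>.1 this)
  have hprop : f • v = k • F := by
    ext i
    refine Fin.lastCases ?_ (fun i => ?_) i
    · simp [← hf, ← hk, mul_comm]
    · simpa using hz i
  have hk0 : k = 0 := by
    have := congrArg (fun u => mink n u w) hprop
    simp only [mink_smul_left, hvw, hFw] at this
    linarith
  rw [hk0, zero_smul] at hprop
  exact (smul_eq_zero.1 hprop).resolve_left hf0

end MinkowskiCalculus

section SpaceFormLifts

variable {n : ℕ}

/-- An immersed lift `F` of a surface to the space-form `E(w)`. -/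
structure SpaceFormLift (F : Surf → MV n) (w : MV n) : Prop where
  smooth : ContDiff ℝ (⊤ : ℕ∞) F
  null : ∀ x, mink n (F x) (F x) = 0
  lift : ∀ x, mink n (F x) w = -1
  immersed : ∀ x, LinearIndependent ℝ ![F x, pd du F x, pd dv F x]

namespace SpaceFormLift

variable {F : Surf → MV n} {w : MV n}

lemma mink_pd_self (hF : SpaceFormLift F w) (e x : Surf) : mink n (pd e F x) (F x) = 0 := by
  have h := mink_pd_eq_neg hF.smooth hF.smooth hF.null e x
  rw [mink_comm (F x)] at h
  linarith

lemma mink_pd_w (hF : SpaceFormLift F w) (e x : Surf) : mink n (pd e F x) w = 0 :=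
  mink_pd_const hF.smooth hF.lift e x

lemma coeff_eq_zero (hF : SpaceFormLift F w) {x : Surf} {a b : ℝ}
    (h : a • pd du F x + b • pd dv F x = 0) : a = 0 ∧ b = 0 := by
  have hli := Fintype.linearIndependent_iff.1 (hF.immersed x) ![0, a, b]
    (by simpa [Fin.sum_univ_three] using h)
  exact ⟨by simpa using hli 1, by simpa using hli 2⟩

lemma gram_pos (hF : SpaceFormLift F w) (x : Surf) {a b : ℝ} (hab : a ≠ 0 ∨ b ≠ 0) :
    0 < a ^ 2 * gUU n F x + 2 * (a * b) * gUV n F x + b ^ 2 * gVV n F x := by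
  have hne : a • pd du F x + b • pd dv F x ≠ 0 := fun h => by
    have := hF.coeff_eq_zero h
    tauto
  have h := mink_self_pos (hF.null x) (hF.lift x)
    (v := a • pd du F x + b • pd dv F x)
    (by simp [mink_add_left, mink_smul_left, hF.mink_pd_self])
    (by simp [mink_add_left, mink_smul_left, hF.mink_pd_w]) hne
  simp only [mink_add_left, mink_smul_left, mink_add_right, mink_smul_right,
    mink_comm (pd dv F x) (pd du F x)] at h
  simp only [gUU, gUV, gVV]
  linarith

lemma gVV_pos (hF : SpaceFormLift F w) (x : Surf) : 0 < gVV n F x := by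
  simpa using hF.gram_pos x (a := 0) (b := 1) (by simp)

lemma gUU_pos (hF : SpaceFormLift F w) (x : Surf) : 0 < gUU n F x := by
  simpa using hF.gram_pos x (a := 1) (b := 0) (by simp)

lemma det_pos (hF : SpaceFormLift F w) (x : Surf) :
    0 < gUU n F x * gVV n F x - gUV n F x ^ 2 := by
  have hG := hF.gVV_pos x
  have h := hF.gram_pos x (a := gVV n F x) (b := -gUV n F x) (Or.inl hG.ne')
  have : 0 < gVV n F x * (gUU n F x * gVV n F x - gUV n F x ^ 2) := by nlinarith
  exact pos_of_mul_pos_right this hG.le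

lemma smooth_gUU (hF : SpaceFormLift F w) : ContDiff ℝ (⊤ : ℕ∞) (gUU n F) :=
  smooth_mink (smooth_pd hF.smooth du) (smooth_pd hF.smooth du)

lemma smooth_gUV (hF : SpaceFormLift F w) : ContDiff ℝ (⊤ : ℕ∞) (gUV n F) :=
  smooth_mink (smooth_pd hF.smooth du) (smooth_pd hF.smooth dv)

lemma smooth_gVV (hF : SpaceFormLift F w) : ContDiff ℝ (⊤ : ℕ∞) (gVV n F) :=
  smooth_mink (smooth_pd hF.smooth dv) (smooth_pd hF.smooth dv)

lemma pd_comm (hF : SpaceFormLift F w) (x : Surf) :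
    pd du (pd dv F) x = pd dv (pd du F) x := fderiv_fderiv_comm hF.smooth x dv du

end SpaceFormLift

/-- A closed 1-form `X₁ du + X₂ dv` with values in the tangent planes of `F`, trace-free as a
tangent endomorphism. -/
structure TracefreeClosedForm (F X₁ X₂ : Surf → MV n) : Prop where
  smooth₁ : ContDiff ℝ (⊤ : ℕ∞) X₁
  smooth₂ : ContDiff ℝ (⊤ : ℕ∞) X₂
  tracefree : ∀ x, ∃ a b c : ℝ, X₁ x = a • pd du F x + b • pd dv F x
    ∧ X₂ x = c • pd du F x - a • pd dv F x
  closed : ∀ x, pd du X₂ x = pd dv X₁ x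

namespace TracefreeClosedForm

variable {F X₁ X₂ : Surf → MV n} {w : MV n}

lemma mink_eq_zero (hX : TracefreeClosedForm F X₁ X₂) {x : Surf} {v : MV n}
    (hu : mink n (pd du F x) v = 0) (hv : mink n (pd dv F x) v = 0) :
    mink n (X₁ x) v = 0 ∧ mink n (X₂ x) v = 0 := by
  obtain ⟨a, b, c, h1, h2⟩ := hX.tracefree x
  simp [h1, h2, mink_add_left, mink_sub_left, mink_smul_left, hu, hv]

/-- A closed form is symmetric with respect to the second fundamental form of any section
orthogonal to its values. -/
lemma symm_of_orthogonal (hX : TracefreeClosedForm F X₁ X₂) {N : Surf → MV n}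
    (hN : ContDiff ℝ (⊤ : ℕ∞) N) (h₁ : ∀ x, mink n (X₁ x) (N x) = 0)
    (h₂ : ∀ x, mink n (X₂ x) (N x) = 0) (x : Surf) :
    mink n (X₁ x) (pd dv N x) = mink n (X₂ x) (pd du N x) := by
  have e1 := mink_pd_eq_neg hX.smooth₁ hN h₁ dv x
  have e2 := mink_pd_eq_neg hX.smooth₂ hN h₂ du x
  rw [hX.closed x] at e2
  linarith

lemma symm (hX : TracefreeClosedForm F X₁ X₂) (hF : SpaceFormLift F w) (x : Surf) :
    mink n (X₁ x) (pd dv F x) = mink n (X₂ x) (pd du F x) :=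
  hX.symm_of_orthogonal hF.smooth
    (fun x => (hX.mink_eq_zero (hF.mink_pd_self du x) (hF.mink_pd_self dv x)).1)
    (fun x => (hX.mink_eq_zero (hF.mink_pd_self du x) (hF.mink_pd_self dv x)).2) x

lemma exists_coeff (hX : TracefreeClosedForm F X₁ X₂) (hF : SpaceFormLift F w) (x : Surf) :
    ∃ a b c : ℝ, X₁ x = a • pd du F x + b • pd dv F x
      ∧ X₂ x = c • pd du F x - a • pd dv F x
      ∧ c * gUU n F x - 2 * a * gUV n F x - b * gVV n F x = 0 := by
  obtain ⟨a, b, c, h1, h2⟩ := hX.tracefree x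
  refine ⟨a, b, c, h1, h2, ?_⟩
  have h := hX.symm hF x
  rw [h1, h2] at h
  simp only [mink_add_left, mink_sub_left, mink_smul_left,
    mink_comm (pd dv F x) (pd du F x)] at h
  simp only [gUU, gUV, gVV]
  linarith

/-- Weak unique continuation for trace-free closed forms. -/
theorem eq_zero_of_eventually_eq_zero (hX : TracefreeClosedForm F X₁ X₂)
    (hF : SpaceFormLift F w) {z₀ : Surf}
    (hz₀ : ∀ᶠ z in nhds z₀, X₁ z = 0 ∧ X₂ z = 0) (z : Surf) : X₁ z = 0 ∧ X₂ z = 0 := by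
  have hG := hF.gVV_pos
  have hD := hF.det_pos
  have sFu := smooth_pd hF.smooth du
  have sFv := smooth_pd hF.smooth dv
  set m : Surf → ℝ := fun z => -gUV n F z / gVV n F z with hmdef
  set r : Surf → ℝ := fun z => Real.sqrt (gUU n F z * gVV n F z - gUV n F z ^ 2) / gVV n F z
    with hrdef
  have sm : ContDiff ℝ (⊤ : ℕ∞) m := hF.smooth_gUV.neg.div hF.smooth_gVV fun z => (hG z).ne'
  have sr : ContDiff ℝ (⊤ : ℕ∞) r :=
    (((hF.smooth_gUU.mul hF.smooth_gVV).sub (hF.smooth_gUV.pow 2)).sqrt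
      fun z => (hD z).ne').div hF.smooth_gVV fun z => (hG z).ne'
  have hr : ∀ z, 0 < r z := fun z => div_pos (Real.sqrt_pos.2 (hD z)) (hG z)
  have hmG : ∀ z, m z * gVV n F z = -gUV n F z := fun z => div_mul_cancel₀ _ (hG z).ne'
  have hrG : ∀ z, r z ^ 2 * gVV n F z ^ 2 = gUU n F z * gVV n F z - gUV n F z ^ 2 := by
    intro z
    rw [← mul_pow, div_mul_cancel₀ _ (hG z).ne', Real.sq_sqrt (hD z).le]
  have hrm : ∀ z, (r z ^ 2 + m z ^ 2) * gVV n F z = gUU n F z := by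
    intro z
    refine mul_right_cancel₀ (hG z).ne' ?_
    linear_combination hrG z + (m z * gVV n F z - gUV n F z) * hmG z
  set γ : Surf → ℝ := fun z => (vfd (fun _ => 1) m r z - vfd (fun _ => 0) r m z) / r z
    with hγdef
  have s1 : ContDiff ℝ (⊤ : ℕ∞) (fun _ : Surf => (1 : ℝ)) := contDiff_const
  have s0 : ContDiff ℝ (⊤ : ℕ∞) (fun _ : Surf => (0 : ℝ)) := contDiff_const
  have sγ : ContDiff ℝ (⊤ : ℕ∞) γ :=
    ((smooth_vfd s1 sm sr).sub (smooth_vfd s0 sr sm)).div sr fun z => (hr z).ne'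
  have hγ : ∀ z, γ z * r z = vfd (fun _ => 1) m r z - vfd (fun _ => 0) r m z :=
    fun z => div_mul_cancel₀ _ (hr z).ne'
  set T : Surf → MV n := fun z => pd du F z + m z • pd dv F z with hTdef
  set S : Surf → MV n := fun z => r z • pd dv F z with hSdef
  set XA : Surf → MV n := fun z => X₁ z + m z • X₂ z with hXAdef
  set XB : Surf → MV n := fun z => r z • X₂ z with hXBdef
  have sT : ContDiff ℝ (⊤ : ℕ∞) T := sFu.add (sm.smul sFv)
  have sS : ContDiff ℝ (⊤ : ℕ∞) S := sr.smul sFv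
  have sXA : ContDiff ℝ (⊤ : ℕ∞) XA := hX.smooth₁.add (sm.smul hX.smooth₂)
  have sXB : ContDiff ℝ (⊤ : ℕ∞) XB := sr.smul hX.smooth₂
  have hS := vpd_closed sm sr sFu sFv hF.pd_comm hγ
  have hXB := vpd_closed sm sr hX.smooth₁ hX.smooth₂ hX.closed hγ
  have hTS : ∀ z, mink n (T z) (S z) = 0 := by
    intro z
    simp only [hTdef, hSdef, mink_add_left, mink_smul_left, mink_smul_right]
    have := hmG z
    simp only [gVV, gUV] at this
    linear_combination r z * this
  have hTT : ∀ z, mink n (T z) (T z) = mink n (S z) (S z) := by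
    intro z
    simp only [hTdef, hSdef, mink_add_left, mink_smul_left, mink_add_right, mink_smul_right,
      mink_comm (pd dv F z) (pd du F z)]
    have e1 := hmG z
    have e2 := hrm z
    simp only [gUU, gVV, gUV] at e1 e2
    linear_combination -e2 + 2 * m z * e1
  have hSS : ∀ z, 0 < mink n (S z) (S z) := by
    intro z
    have := mul_pos (mul_pos (hr z) (hr z)) (hG z)
    simp only [gVV] at this
    simpa only [hSdef, mink_smul_left, mink_smul_right, mul_assoc] using this
  have hcoeff : ∀ z, ∃ x y : ℝ, XA z = x • T z + y • S z ∧ XB z = y • T z - x • S z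
      ∧ (x = 0 → y = 0 → X₁ z = 0 ∧ X₂ z = 0) := by
    intro z
    obtain ⟨a, b, c, h1, h2, h3⟩ := hX.exists_coeff hF z
    have h4 : r z ^ 2 * c = b - 2 * m z * a - m z ^ 2 * c := by
      refine mul_right_cancel₀ (hG z).ne' ?_
      linear_combination c * hrm z + h3 + 2 * a * hmG z
    refine ⟨a + m z * c, r z * c, ?_, ?_, ?_⟩
    · simp only [hXAdef, hTdef, hSdef, h1, h2]
      rw [smul_smul, show r z * c * r z = b - 2 * m z * a - m z ^ 2 * c by rw [← h4]; ring]
      module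
    · simp only [hXBdef, hTdef, hSdef, h2]
      module
    · intro hx hy
      have hc : c = 0 := by simpa [(hr z).ne'] using hy
      have ha : a = 0 := by simpa [hc] using hx
      have hb : b = 0 := by simpa [hc, ha] using h4.symm
      simp [h1, h2, ha, hb, hc]
  set xh : Surf → ℝ := fun z => mink n (XA z) (T z) with hxh
  set yh : Surf → ℝ := fun z => mink n (XA z) (S z) with hyh
  have hx' : xh = fun z => -1 * mink n (XB z) (S z) := by
    funext z
    obtain ⟨x, y, h1, h2, -⟩ := hcoeff z
    simp only [hxh, h1, h2, mink_add_left, mink_sub_left, mink_smul_left,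
      mink_comm (S z) (T z), hTS, hTT]
    ring
  have hy' : yh = fun z => mink n (XB z) (T z) := by
    funext z
    obtain ⟨x, y, h1, h2, -⟩ := hcoeff z
    simp only [hyh, h1, h2, mink_add_left, mink_sub_left, mink_smul_left,
      mink_comm (S z) (T z), hTS, hTT]
    ring
  have dTS : ∀ (p q : Surf → ℝ) z, mink n (vpd p q T z) (S z) + mink n (vpd p q S z) (T z) = 0 := by
    intro p q z
    have h := vfd_mink (p := p) (q := q) sT sS z
    rw [show (fun y => mink n (T y) (S y)) = fun _ => 0 from funext hTS, vfd_const] at h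
    rw [mink_comm (vpd p q S z)]
    exact h.symm
  have dTT : ∀ (p q : Surf → ℝ) z, mink n (vpd p q T z) (T z) = mink n (vpd p q S z) (S z) := by
    intro p q z
    have h := vfd_mink (p := p) (q := q) sT sT z
    rw [show (fun y => mink n (T y) (T y)) = fun y => mink n (S y) (S y) from funext hTT,
      vfd_mink sS sS, mink_comm (S z), mink_comm (T z)] at h
    linarith
  have hsys : CauchyRiemannSystem m r γ xh yh := by
    refine ⟨sm, sr, sγ, smooth_mink sXA sT, smooth_mink sXA sS, fun z => (hr z).ne', hγ,
      fun z => ?_, fun z => ?_⟩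
    · obtain ⟨x, y, h1, h2, -⟩ := hcoeff z
      have hxz := congrFun hx' z
      nth_rewrite 1 [hx']
      rw [vfd_const_mul _ (smooth_mink sXB sS), vfd_mink sXB sS, vfd_mink sXA sS, hXB, hS]
      have t1 := dTS (fun _ => 0) r z
      have t2 := dTT (fun _ => 0) r z
      change mink n (XA z) (T z) = _ at hxz
      change _ = 2 * (γ z * mink n (XA z) (T z)) - _
      have e : mink n (γ z • (r z • X₂ z)) (S z) = γ z * mink n (XB z) (S z) := mink_smul_left _ _ _ _
      have e' : mink n (XB z) (γ z • (r z • pd dv F z)) = γ z * mink n (XB z) (S z) :=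
        mink_smul_right _ _ _
      rw [mink_add_left, mink_add_right, e, e']
      have e2 : mink n (XA z) (vpd (fun _ => 0) r S z)
          = x * mink n (vpd (fun _ => 0) r S z) (T z) + y * mink n (vpd (fun _ => 0) r S z) (S z) := by
        rw [h1, mink_comm, mink_add_right, mink_smul_right, mink_smul_right]
      have e3 : mink n (XB z) (vpd (fun _ => 0) r T z)
          = y * mink n (vpd (fun _ => 0) r T z) (T z) - x * mink n (vpd (fun _ => 0) r T z) (S z) := by
        rw [h2, mink_comm, mink_sub_right, mink_smul_right, mink_smul_right]
      change -1 * (mink n (vpd (fun _ => 0) r XA z) (S z) + γ z * mink n (XB z) (S z)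
        + (mink n (XB z) (vpd (fun _ => 0) r T z) + γ z * mink n (XB z) (S z))) = _
      rw [e2, e3]
      linear_combination x * t1 - y * t2 - 2 * γ z * hxz
    · obtain ⟨x, y, h1, h2, -⟩ := hcoeff z
      have hyz := congrFun hy' z
      nth_rewrite 1 [hy']
      rw [vfd_mink sXB sT, vfd_mink sXA sT, hXB]
      have t1 := dTS (fun _ => 1) m z
      have t2 := dTT (fun _ => 1) m z
      have t3 := dTS (fun _ => 0) r z
      have t4 := dTT (fun _ => 0) r z
      have hSz : vpd (fun _ => 1) m S z = vpd (fun _ => 0) r T z + γ z • S z := hS z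
      rw [hSz, mink_add_left, mink_smul_left] at t1 t2
      rw [mink_comm (S z), hTS] at t1
      change mink n (XA z) (S z) = _ at hyz
      change _ = 2 * (γ z * mink n (XA z) (S z)) + _
      have e : mink n (γ z • (r z • X₂ z)) (T z) = γ z * mink n (XB z) (T z) := mink_smul_left _ _ _ _
      have e2 : mink n (XA z) (vpd (fun _ => 0) r T z)
          = x * mink n (vpd (fun _ => 0) r T z) (T z) + y * mink n (vpd (fun _ => 0) r T z) (S z) := by
        rw [h1, mink_comm, mink_add_right, mink_smul_right, mink_smul_right]
      have e3 : mink n (XB z) (vpd (fun _ => 1) m T z)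
          = y * mink n (vpd (fun _ => 1) m T z) (T z) - x * mink n (vpd (fun _ => 1) m T z) (S z) := by
        rw [h2, mink_comm, mink_sub_right, mink_smul_right, mink_smul_right]
      have e4 : mink n (XB z) (T z) = y * mink n (S z) (S z) := by
        rw [h2, mink_sub_left, mink_smul_left, mink_smul_left, mink_comm (S z) (T z), hTS, hTT]
        ring
      rw [mink_add_left, e, hyz, e2, e3]
      change mink n (vpd (fun _ => 0) r XA z) (T z) + _ + _ = _
      linear_combination y * t2 - x * t1 - γ z * e4
  have hev : ∀ᶠ z in nhds z₀, xh z = 0 ∧ yh z = 0 := by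
    filter_upwards [hz₀] with z hz
    simp [hxh, hyh, hXAdef, hz, mink_zero_left]
  obtain ⟨hxz, hyz⟩ := hsys.eq_zero_of_eventually_eq_zero hev z
  obtain ⟨x, y, h1, -, h3⟩ := hcoeff z
  simp only [hxh, hyh, h1, mink_add_left, mink_smul_left, mink_comm (S z) (T z), hTS, hTT,
    mul_zero, add_zero, zero_add, mul_eq_zero, (hSS z).ne', or_false] at hxz hyz
  exact h3 hxz hyz

end TracefreeClosedForm

end SpaceFormLifts

namespace IsothermicSurface

variable {n : ℕ} {w : MV n}

lemma spaceFormLift (S : IsothermicSurface n) (hlift : ∀ x, mink n (S.F x) w = -1) :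
    SpaceFormLift S.F w := ⟨S.smooth_F, S.F_null, hlift, S.immersed⟩

end IsothermicSurface

section TangentialPart

variable {n : ℕ} {F W W₁ W₂ : Surf → MV n} {w : MV n}

/-- The representative of `W` modulo `F` that is orthogonal to `w`, when `(F,w) = -1`. -/
def tangentialPart (F W : Surf → MV n) (w : MV n) (x : Surf) : MV n :=
  W x + mink n (W x) w • F x

lemma smooth_tangentialPart (hF : ContDiff ℝ (⊤ : ℕ∞) F) (hW : ContDiff ℝ (⊤ : ℕ∞) W) :
    ContDiff ℝ (⊤ : ℕ∞) (tangentialPart F W w) :=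
  hW.add ((smooth_mink hW contDiff_const).smul hF)

lemma wedge_tangentialPart (x : Surf) (z : MV n) :
    wedge n (F x) (tangentialPart F W w x) z = wedge n (F x) (W x) z := by
  simp only [wedge, tangentialPart, mink_add_left, mink_smul_left]
  module

lemma mink_tangentialPart_w (hF : SpaceFormLift F w) (x : Surf) :
    mink n (tangentialPart F W w x) w = 0 := by
  simp [tangentialPart, mink_add_left, mink_smul_left, hF.lift]

lemma wedge_tangentialPart_w (hF : SpaceFormLift F w) (x : Surf) :
    wedge n (F x) (W x) w = -tangentialPart F W w x := by
  rw [← wedge_tangentialPart (w := w)]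
  simp [wedge, hF.lift, mink_tangentialPart_w hF]

lemma pd_wedge {X : Surf → MV n} (hF : ContDiff ℝ (⊤ : ℕ∞) F) (hX : ContDiff ℝ (⊤ : ℕ∞) X)
    (z : MV n) (e x : Surf) :
    pd e (fun y => wedge n (F y) (X y) z) x
      = wedge n (pd e F x) (X x) z + wedge n (F x) (pd e X x) z := by
  have h1 : ∀ {f : Surf → MV n}, ContDiff ℝ (⊤ : ℕ∞) f →
      pdR e (fun y => mink n (f y) z) x = mink n (pd e f x) z := fun hf => by
    rw [pdR_mink hf contDiff_const, mink_comm (_ : MV n) (pd e (fun _ => z) x)]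
    simp [pd, mink_zero_left]
  have sF := smooth_mink hF (contDiff_const (c := z))
  have sX := smooth_mink hX (contDiff_const (c := z))
  have h2 := pd_sub (sF.smul hX) (sX.smul hF) e x
  change pd e (fun y => wedge n (F y) (X y) z) x
    = pd e (fun y => mink n (F y) z • X y) x - pd e (fun y => mink n (X y) z • F y) x at h2
  rw [h2, pd_smul sF hX, pd_smul sX hF, h1 hF, h1 hX]
  simp only [wedge]
  module

/-- The tangential part of a closed 1-form `F ∧ W₁ du + F ∧ W₂ dv` is closed and trace-free. -/
theorem tracefreeClosedForm_tangentialPart (hF : SpaceFormLift F w)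
    (h₁ : ContDiff ℝ (⊤ : ℕ∞) W₁) (h₂ : ContDiff ℝ (⊤ : ℕ∞) W₂)
    (hcl : ∀ x z, pd du (fun y => wedge n (F y) (W₂ y) z) x
      = pd dv (fun y => wedge n (F y) (W₁ y) z) x) :
    TracefreeClosedForm F (tangentialPart F W₁ w) (tangentialPart F W₂ w) := by
  have s₁ := smooth_tangentialPart (w := w) hF.smooth h₁
  have s₂ := smooth_tangentialPart (w := w) hF.smooth h₂
  set X₁ := tangentialPart F W₁ w with hX₁
  set X₂ := tangentialPart F W₂ w with hX₂
  have hX₁w : ∀ x, mink n (X₁ x) w = 0 := mink_tangentialPart_w hF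
  have hX₂w : ∀ x, mink n (X₂ x) w = 0 := mink_tangentialPart_w hF
  have key : ∀ x z, wedge n (pd du F x) (X₂ x) z + wedge n (F x) (pd du X₂ x) z
      = wedge n (pd dv F x) (X₁ x) z + wedge n (F x) (pd dv X₁ x) z := fun x z => by
    rw [← pd_wedge hF.smooth s₂, ← pd_wedge hF.smooth s₁]
    simpa only [hX₁, hX₂, wedge_tangentialPart] using hcl x z
  have closed : ∀ x, pd du X₂ x = pd dv X₁ x := fun x => by
    simpa [wedge, hF.mink_pd_w, hF.lift, hX₁w, hX₂w, mink_pd_const s₁ hX₁w,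
      mink_pd_const s₂ hX₂w] using key x w
  refine ⟨s₁, s₂, fun x => ?_, closed⟩
  have key' : ∀ z, mink n (pd du F x) z • X₂ x - mink n (X₂ x) z • pd du F x
      = mink n (pd dv F x) z • X₁ x - mink n (X₁ x) z • pd dv F x := fun z => by
    have h := key x z
    rw [closed x] at h
    exact add_right_cancel h
  have hD := (hF.det_pos x).ne'
  set D := gUU n F x * gVV n F x - gUV n F x ^ 2 with hDdef
  have h1 := key' (D⁻¹ • (gVV n F x • pd du F x - gUV n F x • pd dv F x))
  have h2 := key' (D⁻¹ • (gUU n F x • pd dv F x - gUV n F x • pd du F x))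
  have e1 : mink n (pd du F x) (D⁻¹ • (gVV n F x • pd du F x - gUV n F x • pd dv F x)) = 1 := by
    rw [mink_smul_right, mink_sub_right, mink_smul_right, mink_smul_right,
      inv_mul_eq_one₀ hD, hDdef]
    simp only [gUU, gUV]; ring
  have e2 : mink n (pd dv F x) (D⁻¹ • (gVV n F x • pd du F x - gUV n F x • pd dv F x)) = 0 := by
    rw [mink_smul_right, mink_sub_right, mink_smul_right, mink_smul_right,
      mink_comm (pd dv F x) (pd du F x)]
    simp only [gVV, gUV]; ring
  have e3 : mink n (pd du F x) (D⁻¹ • (gUU n F x • pd dv F x - gUV n F x • pd du F x)) = 0 := by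
    rw [mink_smul_right, mink_sub_right, mink_smul_right, mink_smul_right]
    simp only [gUU, gUV]; ring
  have e4 : mink n (pd dv F x) (D⁻¹ • (gUU n F x • pd dv F x - gUV n F x • pd du F x)) = 1 := by
    rw [mink_smul_right, mink_sub_right, mink_smul_right, mink_smul_right,
      inv_mul_eq_one₀ hD, hDdef, mink_comm (pd dv F x) (pd du F x)]
    simp only [gVV, gUV]; ring
  rw [e1, e2] at h1
  rw [e3, e4] at h2
  set z₁ := D⁻¹ • (gVV n F x • pd du F x - gUV n F x • pd dv F x)
  set z₂ := D⁻¹ • (gUU n F x • pd dv F x - gUV n F x • pd du F x)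
  have h3 : X₂ x = mink n (X₂ x) z₁ • pd du F x - mink n (X₁ x) z₁ • pd dv F x := by
    linear_combination (norm := module) h1
  have h4 : X₁ x = -mink n (X₂ x) z₂ • pd du F x + mink n (X₁ x) z₂ • pd dv F x := by
    linear_combination (norm := module) -h2
  have h5 : -mink n (X₂ x) z₂ = mink n (X₁ x) z₁ := by
    have := congrArg (fun v => mink n v z₂) h3
    simp only [mink_sub_left, mink_smul_left, e3, e4] at this
    linarith
  exact ⟨_, _, _, h5 ▸ h4, h3⟩

end TangentialPart

section MeanCurvature

variable {n : ℕ} {F N X₁ X₂ P : Surf → MV n} {w : MV n}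

/-- `(𝐇,N)` in terms of the trace of the shape operator of a parallel normal field. -/
lemma meanCurv_eq (hF : SpaceFormLift F w) (hN : ContDiff ℝ (⊤ : ℕ∞) N)
    (hu : ∀ x, mink n (pd du F x) (N x) = 0) (hv : ∀ x, mink n (pd dv F x) (N x) = 0)
    {x : Surf} {a b c d : ℝ} (h₁ : pd du N x = a • pd du F x + b • pd dv F x)
    (h₂ : pd dv N x = c • pd du F x + d • pd dv F x) : meanCurv n F N x = -(a + d) / 2 := by
  have sFu := smooth_pd hF.smooth du
  have sFv := smooth_pd hF.smooth dv
  have e1 := mink_pd_eq_neg sFu hN hu du x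
  have e2 := mink_pd_eq_neg sFv hN hv du x
  have e3 := mink_pd_eq_neg sFu hN hu dv x
  have e4 := mink_pd_eq_neg sFv hN hv dv x
  rw [← hF.pd_comm] at e3
  simp only [h₁, h₂, mink_add_right, mink_smul_right, mink_comm (pd dv F x) (pd du F x)]
    at e1 e2 e3 e4
  have hD := (hF.det_pos x).ne'
  rw [meanCurv, div_eq_div_iff (by simpa using hD) two_ne_zero]
  simp only [gUU, gUV, gVV] at *
  rw [e1, e4]
  linear_combination -2 * mink n (pd du F x) (pd dv F x) * (e2 + e3)

lemma eq_of_pd_orthogonal {f : Surf → MV n} (hf : ContDiff ℝ (⊤ : ℕ∞) f)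
    (hu : ∀ x, mink n (pd du f x) w = 0) (hv : ∀ x, mink n (pd dv f x) w = 0) (x y : Surf) :
    mink n (f x) w = mink n (f y) w := by
  have h : ∀ e x, pdR e (fun y => mink n (f y) w) x = mink n (pd e f x) w := fun e x => by
    rw [pdR_mink hf contDiff_const, mink_comm (_ : MV n) (pd e (fun _ => w) x)]
    simp [pd, mink_zero_left]
  exact eq_of_partials_eq_zero (smooth_mink hf contDiff_const)
    (fun x => (h du x).trans (hu x)) (fun x => (h dv x).trans (hv x)) x y

namespace TracefreeClosedForm

lemma mink_self (hX : TracefreeClosedForm F X₁ X₂) (hF : SpaceFormLift F w) (x : Surf) :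
    mink n (X₁ x) (F x) = 0 ∧ mink n (X₂ x) (F x) = 0 :=
  hX.mink_eq_zero (hF.mink_pd_self du x) (hF.mink_pd_self dv x)

lemma mink_w (hX : TracefreeClosedForm F X₁ X₂) (hF : SpaceFormLift F w) (x : Surf) :
    mink n (X₁ x) w = 0 ∧ mink n (X₂ x) w = 0 :=
  hX.mink_eq_zero (hF.mink_pd_w du x) (hF.mink_pd_w dv x)

lemma mink_eq_zero_of_wedge_eq_zero (hX : TracefreeClosedForm F X₁ X₂)
    (hF : SpaceFormLift F w) (hne : ∃ x, X₁ x ≠ 0 ∨ X₂ x ≠ 0) (hP : ContDiff ℝ (⊤ : ℕ∞) P)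
    (h₁ : ∀ x, wedge n (F x) (X₁ x) (P x) = 0) (h₂ : ∀ x, wedge n (F x) (X₂ x) (P x) = 0)
    (x : Surf) : mink n (F x) (P x) = 0 := by
  by_contra h0
  have aux : ∀ {y : Surf} {X : MV n}, mink n (F y) (P y) ≠ 0 → mink n X w = 0 →
      wedge n (F y) X (P y) = 0 → X = 0 := fun {y X} hy hXw hw => by
    have h := congrArg (fun v => mink n v w) hw
    simp only [wedge, mink_sub_left, mink_smul_left, hXw, hF.lift, mink_zero_left] at h
    have hXP : mink n X (P y) = 0 := by linarith
    simpa [wedge, hXP, hy] using hw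
  have hev : ∀ᶠ y in nhds x, X₁ y = 0 ∧ X₂ y = 0 := by
    filter_upwards [(smooth_mink hF.smooth hP).continuous.continuousAt.eventually_ne h0]
      with y hy
    exact ⟨aux hy (hX.mink_w hF y).1 (h₁ y), aux hy (hX.mink_w hF y).2 (h₂ y)⟩
  obtain ⟨y, hy⟩ := hne
  have := hX.eq_zero_of_eventually_eq_zero hF hev y
  tauto

theorem exists_parallel_normal (hX : TracefreeClosedForm F X₁ X₂)
    (hF : SpaceFormLift F w) (hP : ContDiff ℝ (⊤ : ℕ∞) P) (hP0 : ∃ x, P x ≠ 0)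
    (hPF : ∀ x, mink n (F x) (P x) = 0) {c : ℝ}
    (hPu : ∀ x, pd du P x = c • X₁ x) (hPv : ∀ x, pd dv P x = c • X₂ x) :
    ∃ N : Surf → MV n, ContDiff ℝ (⊤ : ℕ∞) N ∧ IsUnitNormal n F N w
      ∧ ParallelNormal n F N w ∧ ∃ h : ℝ, ∀ x, meanCurv n F N x = h := by
  set κ := mink n (P 0) w with hκdef
  have hκ : ∀ x, mink n (P x) w = κ := fun x =>
    eq_of_pd_orthogonal hP (fun x => by rw [hPu, mink_smul_left, (hX.mink_w hF x).1, mul_zero])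
      (fun x => by rw [hPv, mink_smul_left, (hX.mink_w hF x).2, mul_zero]) x 0
  set M : Surf → MV n := fun x => P x + κ • F x with hM
  have sM : ContDiff ℝ (⊤ : ℕ∞) M := hP.add (hF.smooth.const_smul κ)
  have hMe : ∀ e x, pd e M x = pd e P x + κ • pd e F x := fun e x => by
    rw [← pd_const_smul κ hF.smooth]
    exact pd_add hP (hF.smooth.const_smul κ) e x
  have hMu : ∀ x, pd du M x = c • X₁ x + κ • pd du F x := fun x => by rw [hMe, hPu]
  have hMv : ∀ x, pd dv M x = c • X₂ x + κ • pd dv F x := fun x => by rw [hMe, hPv]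
  have hMw : ∀ x, mink n (M x) w = 0 := fun x => by
    simp [hM, mink_add_left, mink_smul_left, hκ, hF.lift]
  have hMF : ∀ x, mink n (M x) (F x) = 0 := fun x => by
    simp [hM, mink_add_left, mink_smul_left, hF.null, mink_comm (P x), hPF]
  have hMFu : ∀ x, mink n (M x) (pd du F x) = 0 := fun x => by
    have h := mink_pd_eq_neg sM hF.smooth hMF du x
    rw [hMu, mink_add_left, mink_smul_left, mink_smul_left, (hX.mink_self hF x).1,
      hF.mink_pd_self] at h
    linarith
  have hMFv : ∀ x, mink n (M x) (pd dv F x) = 0 := fun x => by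
    have h := mink_pd_eq_neg sM hF.smooth hMF dv x
    rw [hMv, mink_add_left, mink_smul_left, mink_smul_left, (hX.mink_self hF x).2,
      hF.mink_pd_self] at h
    linarith
  have hXM : ∀ x, mink n (X₁ x) (M x) = 0 ∧ mink n (X₂ x) (M x) = 0 := fun x =>
    hX.mink_eq_zero (by rw [mink_comm, hMFu]) (by rw [mink_comm, hMFv])
  set ρ := mink n (M 0) (M 0) with hρdef
  have hρ : ∀ x, mink n (M x) (M x) = ρ := fun x => by
    refine eq_of_partials_eq_zero (smooth_mink sM sM) (fun x => ?_) (fun x => ?_) x 0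
    · refine (pdR_mink sM sM du x).trans ?_
      rw [mink_comm (M x), hMu, mink_add_left, mink_smul_left, mink_smul_left, (hXM x).1,
        mink_comm _ (M x), hMFu]
      simp
    · refine (pdR_mink sM sM dv x).trans ?_
      rw [mink_comm (M x), hMv, mink_add_left, mink_smul_left, mink_smul_left, (hXM x).2,
        mink_comm _ (M x), hMFv]
      simp
  have hM0 : ∃ x, M x ≠ 0 := by
    by_contra! hz
    have hz' : ∀ e x, pd e M x = 0 := fun e x => by
      rw [show M = fun _ => 0 from funext hz]
      simp [pd]
    obtain ⟨a, b, d, h1, h2⟩ := hX.tracefree 0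
    have e1 := (hMu 0).symm.trans (hz' du 0)
    have e2 := (hMv 0).symm.trans (hz' dv 0)
    rw [h1] at e1
    rw [h2] at e2
    have f1 := (hF.coeff_eq_zero (a := c * a + κ) (b := c * b) (x := 0)
      (by rw [← e1]; module)).1
    have f2 := (hF.coeff_eq_zero (a := c * d) (b := -(c * a) + κ) (x := 0)
      (by rw [← e2]; module)).2
    have hκ0 : κ = 0 := by linarith
    obtain ⟨x, hx⟩ := hP0
    exact hx (by simpa [hM, hκ0] using hz x)
  have hρ0 : 0 < ρ := by
    obtain ⟨x, hx⟩ := hM0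
    rw [← hρ x]
    exact mink_self_pos (hF.null x) (hF.lift x) (hMF x) (hMw x) hx
  set s := (Real.sqrt ρ)⁻¹ with hs
  have hss : s * (s * ρ) = 1 := by
    have := Real.mul_self_sqrt hρ0.le
    have h0 := (Real.sqrt_pos.2 hρ0).ne'
    rw [hs]
    field_simp
    nlinarith
  have sN : ContDiff ℝ (⊤ : ℕ∞) (fun x => s • M x) := sM.const_smul s
  have hNe := fun e x => pd_const_smul s sM e x
  have hNX : ∀ x, ∃ a b d : ℝ,
      pd du (fun x => s • M x) x = (s * (c * a + κ)) • pd du F x + (s * (c * b)) • pd dv F x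
      ∧ pd dv (fun x => s • M x) x
        = (s * (c * d)) • pd du F x + (s * (-(c * a) + κ)) • pd dv F x := fun x => by
    obtain ⟨a, b, d, h1, h2⟩ := hX.tracefree x
    refine ⟨a, b, d, ?_, ?_⟩
    · rw [hNe, hMu, h1]; module
    · rw [hNe, hMv, h2]; module
  refine ⟨fun x => s • M x, sN, ⟨fun x => ?_, fun x => ?_, fun x => ?_, fun x => ?_, fun x => ?_⟩,
    fun x e => ?_, -(s * κ), fun x => ?_⟩
  · rw [mink_smul_left, mink_smul_right, hρ, hss]
  · rw [mink_smul_left, hMw, mul_zero]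
  · rw [mink_smul_left, hMF, mul_zero]
  · rw [mink_smul_left, hMFu, mul_zero]
  · rw [mink_smul_left, hMFv, mul_zero]
  · obtain ⟨a, b, d, h1, h2⟩ := hNX x
    simp only [pd] at h1 h2
    rw [eq_du_dv e, map_add, map_smul, map_smul, h1, h2]
    have hu : fderiv ℝ F x du ∈ Submodule.span ℝ {F x, pd du F x, pd dv F x, w} :=
      Submodule.subset_span (by simp [pd])
    have hv : fderiv ℝ F x dv ∈ Submodule.span ℝ {F x, pd du F x, pd dv F x, w} :=
      Submodule.subset_span (by simp [pd])
    exact Submodule.add_mem _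
      (Submodule.smul_mem _ _ (Submodule.add_mem _ (Submodule.smul_mem _ _ hu)
        (Submodule.smul_mem _ _ hv)))
      (Submodule.smul_mem _ _ (Submodule.add_mem _ (Submodule.smul_mem _ _ hu)
        (Submodule.smul_mem _ _ hv)))
  · obtain ⟨a, b, d, h1, h2⟩ := hNX x
    rw [meanCurv_eq hF sN (fun x => by rw [mink_smul_right, mink_comm, hMFu, mul_zero])
      (fun x => by rw [mink_smul_right, mink_comm, hMFv, mul_zero]) h1 h2]
    ring

end TracefreeClosedForm

end MeanCurvature

section Proportionality

variable {n : ℕ} {F N X₁ X₂ Y₁ Y₂ : Surf → MV n} {w : MV n}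

lemma eventually_eq_const_mul {f g : Surf → ℝ} (hf : ContDiff ℝ (⊤ : ℕ∞) f)
    (hg : ContDiff ℝ (⊤ : ℕ∞) g) {x₀ : Surf} (hx₀ : g x₀ ≠ 0)
    (hu : ∀ x, g x ≠ 0 → pdR du f x * g x = pdR du g x * f x)
    (hv : ∀ x, g x ≠ 0 → pdR dv f x * g x = pdR dv g x * f x) :
    ∀ᶠ x in nhds x₀, f x = f x₀ / g x₀ * g x := by
  obtain ⟨ε, hε, hball⟩ := Metric.eventually_nhds_iff_ball.1
    (hg.continuous.continuousAt.eventually_ne hx₀)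
  have hd : ∀ x ∈ Metric.ball x₀ ε, DifferentiableAt ℝ (fun y => f y / g y) x := fun x hx =>
    (hf.contDiffAt.div hg.contDiffAt (hball x hx)).differentiableAt (by simp)
  have hz : Set.EqOn (fderiv ℝ (fun y => f y / g y)) 0 (Metric.ball x₀ ε) := by
    intro x hx
    have hgx := hball x hx
    have hev : f =ᶠ[nhds x] fun y => f y / g y * g y := by
      filter_upwards [hg.continuous.continuousAt.eventually_ne hgx] with y hy
      rw [div_mul_cancel₀ _ hy]
    have h := Filter.EventuallyEq.fderiv_eq (𝕜 := ℝ) hev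
    rw [fderiv_fun_mul (hd x hx) (smooth_differentiableAt hg x)] at h
    have aux : ∀ e, pdR e f x * g x = pdR e g x * f x →
        fderiv ℝ (fun y => f y / g y) x e = 0 := fun e he => by
      have h' := congrArg (fun L : Surf →L[ℝ] ℝ => L e) h
      simp only [add_apply, smul_apply,
        smul_eq_mul] at h'
      change pdR e f x = f x / g x * pdR e g x + _ at h'
      rw [h'] at he
      have h2 : fderiv ℝ (fun y => f y / g y) x e * (g x * g x) = 0 := by
        have h3 := div_mul_cancel₀ (f x) hgx
        linear_combination he - pdR e g x * h3
      simpa [hgx] using h2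
    exact clm_eq_zero (aux du (hu x hgx)) (aux dv (hv x hgx))
  filter_upwards [Metric.ball_mem_nhds x₀ hε] with x hx
  rw [← Metric.isOpen_ball.is_const_of_fderiv_eq_zero (convex_ball x₀ ε).isPreconnected
    (fun y hy => (hd y hy).differentiableWithinAt) hz hx (Metric.mem_ball_self hε),
    div_mul_cancel₀ _ (hball x hx)]

namespace TracefreeClosedForm

lemma sub_const_smul (hY : TracefreeClosedForm F Y₁ Y₂) (hX : TracefreeClosedForm F X₁ X₂)
    (k : ℝ) : TracefreeClosedForm F (fun x => Y₁ x - k • X₁ x) (fun x => Y₂ x - k • X₂ x) := by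
  have h₁ := hX.smooth₁.const_smul k
  have h₂ := hX.smooth₂.const_smul k
  refine ⟨hY.smooth₁.sub h₁, hY.smooth₂.sub h₂, fun x => ?_, fun x => ?_⟩
  · obtain ⟨a, b, c, e1, e2⟩ := hX.tracefree x
    obtain ⟨a', b', c', e3, e4⟩ := hY.tracefree x
    refine ⟨a' - k * a, b' - k * b, c' - k * c, ?_, ?_⟩
    · rw [e1, e3]; module
    · rw [e2, e4]; module
  · refine (pd_sub hY.smooth₂ h₂ du x).trans (.trans ?_ (pd_sub hY.smooth₁ h₁ dv x).symm)
    rw [hY.closed]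
    congr 1
    exact (pd_const_smul k hX.smooth₂ du x).trans
      (.trans (by rw [hX.closed]) (pd_const_smul k hX.smooth₁ dv x).symm)

lemma eq_zero_of_smul_eq_smul (hX : TracefreeClosedForm F X₁ X₂) (hF : SpaceFormLift F w)
    {x : Surf} (hx : X₁ x ≠ 0 ∨ X₂ x ≠ 0) {α β : ℝ} (h : α • X₂ x = β • X₁ x) :
    α = 0 ∧ β = 0 := by
  obtain ⟨a, b, c, h1, h2, h3⟩ := hX.exists_coeff hF x
  have hE := hF.gUU_pos x
  have hab : a ≠ 0 ∨ b ≠ 0 := by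
    by_contra! hab
    obtain ⟨rfl, rfl⟩ := hab
    have hc : c = 0 := by simpa [hE.ne'] using h3
    simp [h1, h2, hc] at hx
  have hpos : 0 < a ^ 2 + b * c := by
    have := hF.gram_pos x hab
    refine pos_of_mul_pos_right (a := gUU n F x) ?_ hE.le
    linear_combination this - b * h3
  rw [h1, h2] at h
  obtain ⟨e1, e2⟩ := hF.coeff_eq_zero (a := α * c - β * a) (b := -(α * a) - β * b) (x := x)
    (by linear_combination (norm := module) h)
  constructor
  · refine (mul_eq_zero.1 (?_ : α * (a ^ 2 + b * c) = 0)).resolve_right hpos.ne'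
    linear_combination b * e1 - a * e2
  · refine (mul_eq_zero.1 (?_ : β * (a ^ 2 + b * c) = 0)).resolve_right hpos.ne'
    linear_combination -a * e1 - c * e2

/-- Trace-free closed forms which commute as symmetric endomorphisms are proportional. -/
lemma exists_eq_smul (hX : TracefreeClosedForm F X₁ X₂) (hY : TracefreeClosedForm F Y₁ Y₂)
    (hF : SpaceFormLift F w) {x : Surf} (hx : X₁ x ≠ 0 ∨ X₂ x ≠ 0)
    (h : mink n (X₁ x) (Y₂ x) = mink n (X₂ x) (Y₁ x)) :
    ∃ k : ℝ, Y₁ x = k • X₁ x ∧ Y₂ x = k • X₂ x := by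
  obtain ⟨a, b, c, h1, h2, h3⟩ := hX.exists_coeff hF x
  obtain ⟨a', b', c', h4, h5, h6⟩ := hY.exists_coeff hF x
  have hE := (hF.gUU_pos x).ne'
  have hD := (hF.det_pos x).ne'
  rw [h1, h2, h4, h5] at h
  simp only [mink_add_left, mink_sub_left, mink_add_right, mink_sub_right, mink_smul_left,
    mink_smul_right, mink_comm (pd dv F x) (pd du F x)] at h
  have h' : (c * a' - a * c') * gUU n F x + (c * b' - b * c') * gUV n F x
      + (b * a' - a * b') * gVV n F x = 0 := by
    simp only [gUU, gUV, gVV]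
    linear_combination -h
  have hr : b * a' - a * b' = 0 := by
    refine (mul_eq_zero.1 (?_ : (b * a' - a * b')
      * (gUU n F x * gVV n F x - gUV n F x ^ 2) = 0)).resolve_right hD
    linear_combination gUU n F x / 2 * h' - (gUU n F x * a' + gUV n F x * b') / 2 * h3
      + (gUU n F x * a + gUV n F x * b) / 2 * h6
  have hp : c * a' - a * c' = 0 := by
    refine (mul_eq_zero.1 (?_ : (c * a' - a * c') * gUU n F x = 0)).resolve_right hE
    linear_combination a' * h3 - a * h6 + gVV n F x * hr
  have hq : c * b' - b * c' = 0 := by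
    refine (mul_eq_zero.1 (?_ : (c * b' - b * c') * gUU n F x = 0)).resolve_right hE
    linear_combination b' * h3 - b * h6 - 2 * gUV n F x * hr
  have hv : ¬(a = 0 ∧ b = 0 ∧ c = 0) := by
    rintro ⟨rfl, rfl, rfl⟩
    simp [h1, h2] at hx
  obtain ⟨k, rfl, rfl, rfl⟩ : ∃ k, a' = k * a ∧ b' = k * b ∧ c' = k * c := by
    by_cases ha : a = 0
    · by_cases hb : b = 0
      · have hc : c ≠ 0 := by tauto
        refine ⟨c' / c, ?_, ?_, ?_⟩ <;> field_simp <;> linarith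
      · refine ⟨b' / b, ?_, ?_, ?_⟩ <;> field_simp <;> linarith
    · refine ⟨a' / a, ?_, ?_, ?_⟩ <;> field_simp <;> linarith
  exact ⟨k, by rw [h1, h4]; module, by rw [h2, h5]; module⟩

theorem exists_eq_const_smul (hX : TracefreeClosedForm F X₁ X₂)
    (hY : TracefreeClosedForm F Y₁ Y₂) (hF : SpaceFormLift F w)
    (hne : ∃ x, X₁ x ≠ 0 ∨ X₂ x ≠ 0)
    (h : ∀ x, mink n (X₁ x) (Y₂ x) = mink n (X₂ x) (Y₁ x)) :
    ∃ k : ℝ, ∀ x, Y₁ x = k • X₁ x ∧ Y₂ x = k • X₂ x := by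
  set f : Surf → ℝ := fun x => mink n (Y₁ x) (X₁ x) + mink n (Y₂ x) (X₂ x) with hf
  set g : Surf → ℝ := fun x => mink n (X₁ x) (X₁ x) + mink n (X₂ x) (X₂ x) with hg
  have sf : ContDiff ℝ (⊤ : ℕ∞) f :=
    (smooth_mink hY.smooth₁ hX.smooth₁).add (smooth_mink hY.smooth₂ hX.smooth₂)
  have sg : ContDiff ℝ (⊤ : ℕ∞) g :=
    (smooth_mink hX.smooth₁ hX.smooth₁).add (smooth_mink hX.smooth₂ hX.smooth₂)
  have hgne : ∀ x, X₁ x ≠ 0 ∨ X₂ x ≠ 0 → g x ≠ 0 := fun x hx => by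
    have aux : ∀ {v : MV n}, mink n v (F x) = 0 → mink n v w = 0 → v ≠ 0 → 0 < mink n v v :=
      fun h1 h2 hv => mink_self_pos (hF.null x) (hF.lift x) h1 h2 hv
    have p1 := fun h0 => aux (hX.mink_self hF x).1 (hX.mink_w hF x).1 h0
    have p2 := fun h0 => aux (hX.mink_self hF x).2 (hX.mink_w hF x).2 h0
    by_cases h1 : X₁ x = 0
    · simpa [hg, h1, mink_zero_left] using (p2 (hx.resolve_left (not_not.2 h1))).ne'
    · by_cases h2 : X₂ x = 0
      · simpa [hg, h2, mink_zero_left] using (p1 h1).ne'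
      · exact (add_pos (p1 h1) (p2 h2)).ne'
  have hprop : ∀ x, X₁ x ≠ 0 ∨ X₂ x ≠ 0 → g x • Y₁ x = f x • X₁ x ∧ g x • Y₂ x = f x • X₂ x := by
    intro x hx
    obtain ⟨k, h1, h2⟩ := hX.exists_eq_smul hY hF hx (h x)
    have : f x = k * g x := by simp only [hf, hg, h1, h2, mink_smul_left]; ring
    rw [this, h1, h2]
    constructor <;> module
  have hgX : ∀ x, g x ≠ 0 → X₁ x ≠ 0 ∨ X₂ x ≠ 0 := fun x hx => by
    by_contra! hz
    simp [hg, hz, mink_zero_left] at hx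
  have hdiff : ∀ x, g x ≠ 0 → (pdR du f x * g x - pdR du g x * f x) • X₂ x
      = (pdR dv f x * g x - pdR dv g x * f x) • X₁ x := by
    intro x hx
    have hev : ∀ᶠ y in nhds x, g y • Y₁ y = f y • X₁ y ∧ g y • Y₂ y = f y • X₂ y := by
      filter_upwards [sg.continuous.continuousAt.eventually_ne hx] with y hy
      exact hprop y (hgX y hy)
    have d1 : pd dv (fun y => g y • Y₁ y) x = pd dv (fun y => f y • X₁ y) x := by
      simp only [pd]
      rw [Filter.EventuallyEq.fderiv_eq (hev.mono fun y hy => hy.1)]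
    have d2 : pd du (fun y => g y • Y₂ y) x = pd du (fun y => f y • X₂ y) x := by
      simp only [pd]
      rw [Filter.EventuallyEq.fderiv_eq (hev.mono fun y hy => hy.2)]
    rw [pd_smul sg hY.smooth₁, pd_smul sf hX.smooth₁] at d1
    rw [pd_smul sg hY.smooth₂, pd_smul sf hX.smooth₂, hX.closed, hY.closed] at d2
    obtain ⟨e1, e2⟩ := hev.self_of_nhds
    linear_combination (norm := module) g x • d1 - g x • d2 - pdR dv g x • e1 + pdR du g x • e2
  have hzero := fun x hx => hX.eq_zero_of_smul_eq_smul hF (hgX x hx) (hdiff x hx)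
  obtain ⟨x₀, hx₀⟩ := hne
  have hev := eventually_eq_const_mul sf sg (hgne x₀ hx₀)
    (fun x hx => sub_eq_zero.1 (hzero x hx).1) (fun x hx => sub_eq_zero.1 (hzero x hx).2)
  set k := f x₀ / g x₀
  refine ⟨k, fun x => ?_⟩
  have hz := (hY.sub_const_smul hX k).eq_zero_of_eventually_eq_zero hF (z₀ := x₀) (by
    filter_upwards [hev, sg.continuous.continuousAt.eventually_ne (hgne x₀ hx₀)] with y hy hgy
    obtain ⟨e1, e2⟩ := hprop y (hgX y hgy)
    rw [hy] at e1 e2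
    constructor
    · refine smul_right_injective _ hgy ?_
      simp only [smul_sub, e1]
      module
    · refine smul_right_injective _ hgy ?_
      simp only [smul_sub, e2]
      module) x
  exact ⟨sub_eq_zero.1 hz.1, sub_eq_zero.1 hz.2⟩

end TracefreeClosedForm

end Proportionality

section GeneralisedHSurfaces

variable {n : ℕ} {F N : Surf → MV n} {w : MV n}

lemma exists_pd_eq_of_parallelNormal (hF : SpaceFormLift F w) (hN : ContDiff ℝ (⊤ : ℕ∞) N)
    (hunit : IsUnitNormal n F N w) (hpar : ParallelNormal n F N w) (e x : Surf) :
    ∃ a b : ℝ, pd e N x = a • pd du F x + b • pd dv F x := by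
  obtain ⟨-, hNw, hNF, hNu, hNv⟩ := hunit
  have hmem := hpar x e
  simp only [Submodule.mem_span_insert, Submodule.mem_span_singleton] at hmem
  obtain ⟨k, _, ⟨a, _, ⟨b, _, ⟨l, rfl⟩, rfl⟩, rfl⟩, h⟩ := hmem
  have hNe : mink n (N x) (pd e F x) = 0 := by
    change mink n (N x) (fderiv ℝ F x e) = 0
    rw [eq_du_dv e, map_add, map_smul, map_smul, mink_add_right, mink_smul_right,
      mink_smul_right]
    change _ * mink n (N x) (pd du F x) + _ * mink n (N x) (pd dv F x) = 0
    simp [hNu, hNv]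
  have h1 := mink_pd_eq_neg hN hF.smooth hNF e x
  have h2 := mink_pd_const hN hNw e x
  change pd e N x = _ at h
  rw [h] at h1 h2
  simp only [mink_add_left, mink_smul_left, hF.null, hF.mink_pd_self, hNe, mink_comm w (F x),
    hF.lift, hF.mink_pd_w] at h1 h2
  have hl : l = 0 := by linarith
  subst hl
  have hk : k = 0 := by linarith
  exact ⟨a, b, by rw [h, hk]; module⟩

/-- The derivative of `N + hF` for a parallel unit normal field `N` with `(𝐇,N) = h`. -/
lemma tracefreeClosedForm_of_parallelNormal (hF : SpaceFormLift F w)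
    (hN : ContDiff ℝ (⊤ : ℕ∞) N) (hunit : IsUnitNormal n F N w)
    (hpar : ParallelNormal n F N w) {h : ℝ} (hh : ∀ x, meanCurv n F N x = h) :
    TracefreeClosedForm F (fun x => pd du N x + h • pd du F x)
      (fun x => pd dv N x + h • pd dv F x) := by
  have hu : ∀ x, mink n (pd du F x) (N x) = 0 := fun x => by rw [mink_comm, hunit.2.2.2.1]
  have hv : ∀ x, mink n (pd dv F x) (N x) = 0 := fun x => by rw [mink_comm, hunit.2.2.2.2]
  have s : ∀ e, ContDiff ℝ (⊤ : ℕ∞) (fun x => h • pd e F x) := fun e =>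
    (smooth_pd hF.smooth e).const_smul h
  refine ⟨(smooth_pd hN du).add (s du), (smooth_pd hN dv).add (s dv), fun x => ?_, fun x => ?_⟩
  · obtain ⟨a, b, h1⟩ := exists_pd_eq_of_parallelNormal hF hN hunit hpar du x
    obtain ⟨c, d, h2⟩ := exists_pd_eq_of_parallelNormal hF hN hunit hpar dv x
    have hm := meanCurv_eq hF hN hu hv h1 h2
    rw [hh] at hm
    have hd : d = -a - 2 * h := by linarith
    refine ⟨a + h, b, c, ?_, ?_⟩
    · rw [h1]; module
    · rw [h2, hd]; module
  · rw [pd_add (smooth_pd hN dv) (s dv), pd_add (smooth_pd hN du) (s du),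
      pd_const_smul h (smooth_pd hF.smooth dv), pd_const_smul h (smooth_pd hF.smooth du),
      hF.pd_comm, show pd du (pd dv N) x = pd dv (pd du N) x from fderiv_fderiv_comm hN x dv du]

lemma wedge_smul (u v : MV n) (k : ℝ) (z : MV n) : wedge n u v (k • z) = k • wedge n u v z := by
  simp only [wedge, mink_smul_right]
  module

end GeneralisedHSurfaces

namespace IsothermicSurface

variable {n : ℕ} {w : MV n}

lemma tracefreeClosedForm (S : IsothermicSurface n) (hlift : ∀ x, mink n (S.F x) w = -1) :
    TracefreeClosedForm S.F (tangentialPart S.F S.W₁ w) (tangentialPart S.F S.W₂ w) :=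
  tracefreeClosedForm_tangentialPart (S.spaceFormLift hlift) S.smooth_W₁ S.smooth_W₂
    S.eta_closed

lemma tangentialPart_ne_zero (S : IsothermicSurface n) (w : MV n) :
    ∃ x, tangentialPart S.F S.W₁ w x ≠ 0 ∨ tangentialPart S.F S.W₂ w x ≠ 0 := by
  obtain ⟨x, z, h⟩ := S.eta_ne
  refine ⟨x, ?_⟩
  by_contra! h0
  rw [← wedge_tangentialPart (W := S.W₁) (w := w), ← wedge_tangentialPart (W := S.W₂) (w := w),
    h0.1, h0.2] at h
  simp [wedge, mink_zero_left] at h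

/-- `p₀ + t p₁` with `p₀` constant is a conserved quantity iff `dp₁ + ηp₀ = 0` and `ηp₁ = 0`. -/
lemma parallelSection_linear_iff (S : IsothermicSurface n) (v : MV n) {P : Surf → MV n}
    (hP : ContDiff ℝ (⊤ : ℕ∞) P) :
    (∀ t : ℝ, ParallelSection n S t (fun x => v + t • P x)) ↔
      ∀ x, (pd du P x + wedge n (S.F x) (S.W₁ x) v = 0 ∧ wedge n (S.F x) (S.W₁ x) (P x) = 0)
        ∧ pd dv P x + wedge n (S.F x) (S.W₂ x) v = 0 ∧ wedge n (S.F x) (S.W₂ x) (P x) = 0 := by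
  have key : ∀ (t : ℝ) (e x : Surf) (W : MV n),
      fderiv ℝ (fun x => v + t • P x) x e + t • wedge n (S.F x) W (v + t • P x)
        = t • (pd e P x + wedge n (S.F x) W v) + (t * t) • wedge n (S.F x) W (P x) := by
    intro t e x W
    have h : fderiv ℝ (fun x => v + t • P x) x e = t • pd e P x := by
      rw [fderiv_const_add]
      exact pd_const_smul t hP e x
    rw [h]
    simp only [wedge, mink_add_right, mink_smul_right]
    module
  have aux : ∀ A B : MV n, (∀ t : ℝ, t • A + (t * t) • B = 0) → A = 0 ∧ B = 0 := by
    intro A B h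
    have h1 := h 1
    have h2 := h (-1)
    constructor
    · linear_combination (norm := module) (1 / 2 : ℝ) • h1 - (1 / 2 : ℝ) • h2
    · linear_combination (norm := module) (1 / 2 : ℝ) • h1 + (1 / 2 : ℝ) • h2
  simp only [ParallelSection, key]
  constructor
  · intro h x
    exact ⟨aux _ _ fun t => (h t x).1, aux _ _ fun t => (h t x).2⟩
  · intro h t x
    simp [h x]

end IsothermicSurface

/-- A full isothermic surface is special isothermic of type `1` in the
space-form `E(w)` if and only if its lift `F : Σ → E(w)` is a generalised
H-surface: it admits a parallel unit normal field `N` with `(𝐇,N)` constant. -/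
theorem special_type_one_iff_generalised_H (n : ℕ) (hn : 3 ≤ n)
    (S : IsothermicSurface n) (hfull : Full n S) (w : MV n) (hw : w ≠ 0)
    (hlift : ∀ x, mink n (S.F x) w = -1) :
    (∃ p : PolyConservedQuantity n S 1, InSpaceForm p w) ↔
      ∃ N : Surf → MV n, ContDiff ℝ (⊤ : ℕ∞) N ∧ IsUnitNormal n S.F N w
        ∧ ParallelNormal n S.F N w
        ∧ ∃ h : ℝ, ∀ x, meanCurv n S.F N x = h := by
  have hF := S.spaceFormLift hlift
  have hX := S.tracefreeClosedForm hlift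
  have hXne := S.tangentialPart_ne_zero w
  constructor
  · rintro ⟨p, c, hc⟩
    have hP := p.smooth 1
    have hsum : ∀ t : ℝ, (fun x => ∑ k ∈ Finset.range (1 + 1), t ^ k • p.coeff k x)
        = fun x => c • w + t • p.coeff 1 x := fun t => by
      simp [Finset.sum_range_succ, hc]
    have hcons := (S.parallelSection_linear_iff (c • w) hP).1 fun t => hsum t ▸ p.conserved t
    simp only [wedge_smul, wedge_tangentialPart_w hF, smul_neg, add_neg_eq_zero] at hcons
    have hPF := hX.mink_eq_zero_of_wedge_eq_zero hF hXne hP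
      (fun x => (wedge_tangentialPart x _).trans (hcons x).1.2)
      (fun x => (wedge_tangentialPart x _).trans (hcons x).2.2)
    exact hX.exists_parallel_normal hF hP (Function.ne_iff.1 p.top_ne) hPF
      (fun x => (hcons x).1.1) (fun x => (hcons x).2.1)
  · rintro ⟨N, hN, hunit, hpar, h, hh⟩
    have hY := tracefreeClosedForm_of_parallelNormal hF hN hunit hpar hh
    obtain ⟨k, hk⟩ := hX.exists_eq_const_smul hY hF hXne fun x => by
      have hXN := fun x => hX.mink_eq_zero (v := N x) (x := x)
        (by rw [mink_comm, hunit.2.2.2.1]) (by rw [mink_comm, hunit.2.2.2.2])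
      rw [mink_add_right, mink_add_right, mink_smul_right, mink_smul_right, hX.symm hF,
        hX.symm_of_orthogonal hN (fun x => (hXN x).1) fun x => (hXN x).2]
    set P : Surf → MV n := fun x => N x + h • S.F x with hPdef
    have hP : ContDiff ℝ (⊤ : ℕ∞) P := hN.add (hF.smooth.const_smul h)
    have hPe : ∀ e x, pd e P x = pd e N x + h • pd e S.F x := fun e x =>
      (pd_add hN (hF.smooth.const_smul h) e x).trans
        (congrArg _ (pd_const_smul h hF.smooth e x))
    have hFP : ∀ x, mink n (S.F x) (P x) = 0 := fun x => by
      simp [hPdef, mink_add_right, mink_smul_right, hF.null, mink_comm _ (N x), hunit.2.2.1]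
    have hXP := fun x => hX.mink_eq_zero (v := P x) (x := x)
      (by simp [hPdef, mink_add_right, mink_smul_right, hF.mink_pd_self, mink_comm _ (N x),
        hunit.2.2.2.1])
      (by simp [hPdef, mink_add_right, mink_smul_right, hF.mink_pd_self, mink_comm _ (N x),
        hunit.2.2.2.2])
    have hcons := (S.parallelSection_linear_iff (k • w) hP).2 fun x => by
      rw [wedge_smul, wedge_smul, wedge_tangentialPart_w hF, wedge_tangentialPart_w hF, hPe, hPe,
        (hk x).1, (hk x).2, ← wedge_tangentialPart (W := S.W₁) (w := w),
        ← wedge_tangentialPart (W := S.W₂) (w := w)]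
      simp [wedge, hFP, hXP]
    refine ⟨⟨fun j => if j = 0 then fun _ => k • w else if j = 1 then P else 0, fun j => ?_,
      fun j hj => ?_, fun h0 => ?_, fun t => ?_⟩, k, fun x => by simp⟩
    · split_ifs
      exacts [contDiff_const, hP, contDiff_const]
    · rw [if_neg (by omega), if_neg (by omega)]
    · have hN0 := hunit.1 0
      have hP0 : P 0 = 0 := congrFun h0 0
      have hPN : mink n (P 0) (N 0) = 1 := by
        simp only [hPdef, mink_add_left, mink_smul_left, hN0, mink_comm (S.F 0), hunit.2.2.1,
          mul_zero, add_zero]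
      rw [hP0, mink_zero_left] at hPN
      exact zero_ne_one hPN
    · simpa [Finset.sum_range_succ] using hcons t
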